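/- arXiv:1810.07408 — 5 statements merged into one kernel-verified Lean document; each statement's English description precedes it below -/
import Mathlib

section
/- In the derived Kac–Moody algebra g(A) of a symmetrizable generalized Cartan matrix A, with Y_i := e_i − f_i, for all 1 ≤ i ≠ j ≤ n and all integers r ≥ 0 one has Σ_{s=0}^{r} c_s^{ij}[r] (ad Y_i)^s Y_j = (ad e_i)^r e_j + (−1)^{r−1} (ad f_i)^r f_j. -/
/-! Preamble: the derived Kac–Moody algebra of a symmetrizable generalized Cartan matrix,
presented by Chevalley generators and the Serre relations. -/

/-- The generators `e i`, `f i`, `h i` of the derived Kac–Moody algebra. -/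
inductive KMGen (n : ℕ) : Type
  | E : Fin n → KMGen n
  | F : Fin n → KMGen n
  | H : Fin n → KMGen n

/-- A symmetrizable generalized Cartan matrix. -/
structure GCM (n : ℕ) where
  a : Fin n → Fin n → ℤ
  diag : ∀ i, a i i = 2
  off_nonpos : ∀ i j, i ≠ j → a i j ≤ 0
  zero_iff : ∀ i j, a i j = 0 ↔ a j i = 0
  symmetrizable : ∃ d : Fin n → ℚ, (∀ i, 0 < d i) ∧ ∀ i j, d i * a i j = d j * a j i

namespace KacMoody

variable {n : ℕ}

/-- The free Lie algebra over `ℂ` on the generators. -/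
abbrev FL (n : ℕ) : Type := FreeLieAlgebra ℂ (KMGen n)

noncomputable def Ef (i : Fin n) : FL n := FreeLieAlgebra.of ℂ (KMGen.E i)
noncomputable def Ff (i : Fin n) : FL n := FreeLieAlgebra.of ℂ (KMGen.F i)
noncomputable def Hf (i : Fin n) : FL n := FreeLieAlgebra.of ℂ (KMGen.H i)

/-- The defining relations of the derived Kac–Moody algebra. -/
noncomputable def relations (A : GCM n) : Set (FL n) :=
  (Set.range fun p : Fin n × Fin n => ⁅Hf p.1, Hf p.2⁆) ∪
  (Set.range fun p : Fin n × Fin n => ⁅Hf p.1, Ef p.2⁆ - (A.a p.1 p.2 : ℂ) • Ef p.2) ∪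
  (Set.range fun p : Fin n × Fin n => ⁅Hf p.1, Ff p.2⁆ + (A.a p.1 p.2 : ℂ) • Ff p.2) ∪
  (Set.range fun p : Fin n × Fin n =>
    ⁅Ef p.1, Ff p.2⁆ - if p.1 = p.2 then Hf p.1 else 0) ∪
  {x | ∃ i j : Fin n, i ≠ j ∧
    x = ((LieAlgebra.ad ℂ (FL n) (Ef i)) ^ (1 - A.a i j).toNat) (Ef j)} ∪
  {x | ∃ i j : Fin n, i ≠ j ∧
    x = ((LieAlgebra.ad ℂ (FL n) (Ff i)) ^ (1 - A.a i j).toNat) (Ff j)}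

/-- The Lie ideal generated by the relations. -/
noncomputable def relIdeal (A : GCM n) : LieIdeal ℂ (FL n) :=
  LieSubmodule.lieSpan ℂ (FL n) (relations A)

/-- The derived Kac–Moody algebra `g(A)`. -/
abbrev KM (A : GCM n) : Type := FL n ⧸ relIdeal A

/-- The Chevalley generators of `g(A)`. -/
noncomputable def e (A : GCM n) (i : Fin n) : KM A :=
  LieSubmodule.Quotient.mk (N := relIdeal A) (Ef i)

noncomputable def f (A : GCM n) (i : Fin n) : KM A :=
  LieSubmodule.Quotient.mk (N := relIdeal A) (Ff i)

noncomputable def h (A : GCM n) (i : Fin n) : KM A :=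
  LieSubmodule.Quotient.mk (N := relIdeal A) (Hf i)

/-- `Y i = e i - f i`. -/
noncomputable def Y (A : GCM n) (i : Fin n) : KM A := e A i - f A i

end KacMoody

/-- The integers `c_s[r]` (depending on an integer parameter `a`), defined by
`c_r[r] = 1`, `c_{r-1}[r] = 0` and the recursion
`c_s[r] = c_{s-1}[r-1] - (r-1)(r-2+a) c_s[r-2]` (with `c_{-1}[r] := 0`);
we set `c_s[r] = 0` for `s > r`.  Here `onsagerC a r s = c_s[r]`. -/
def onsagerC (a : ℤ) : ℕ → ℕ → ℤ
  | 0, s => if s = 0 then 1 else 0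
  | 1, s => if s = 1 then 1 else 0
  | (r + 2), s =>
      (if s = 0 then 0 else onsagerC a (r + 1) (s - 1)) -
        ((r : ℤ) + 1) * ((r : ℤ) + a) * onsagerC a r s

section Aux

variable {L : Type*} [LieRing L] [LieAlgebra ℂ L]

lemma aux_h (h e x : L) (a b : ℂ) (h1 : ⁅h, e⁆ = b • e) (h2 : ⁅h, x⁆ = a • x) (r : ℕ) :
    ⁅h, ((LieAlgebra.ad ℂ L e) ^ r) x⁆ = (b * r + a) • ((LieAlgebra.ad ℂ L e) ^ r) x := by
  induction r with
  | zero => simp [h2]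
  | succ r ih =>
    rw [pow_succ', Module.End.mul_apply, LieAlgebra.ad_apply, leibniz_lie, h1, ih, smul_lie,
      lie_smul, ← add_smul]
    push_cast
    congr 1
    ring

/-- Lowering, for a triple with `⁅f, e⁆ = -h`, `⁅h, e⁆ = b e`. -/
lemma aux_f (h e f x : L) (a b : ℂ) (h0 : ⁅f, e⁆ = -h) (h1 : ⁅h, e⁆ = (2 * b) • e)
    (h2 : ⁅h, x⁆ = (b * a) • x) (h3 : ⁅f, x⁆ = 0) (r : ℕ) :
    ⁅f, ((LieAlgebra.ad ℂ L e) ^ (r + 1)) x⁆ =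
      (-(b * ((r + 1) * (r + a)))) • ((LieAlgebra.ad ℂ L e) ^ r) x := by
  induction r with
  | zero => simp [leibniz_lie f e x, h0, h2, h3]
  | succ r ih =>
    rw [pow_succ', Module.End.mul_apply, LieAlgebra.ad_apply, leibniz_lie, h0, ih, neg_lie,
      aux_h h e x _ _ h1 h2, lie_smul, ← LieAlgebra.ad_apply ℂ L e, ← Module.End.mul_apply,
      ← pow_succ', ← neg_smul, ← add_smul]
    push_cast
    congr 1
    ring

lemma aux_zero (a : ℤ) (r : ℕ) : ∀ s, r < s → onsagerC a r s = 0 := by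
  induction r using Nat.twoStepInduction with
  | zero => intro s hs; simp [onsagerC]; omega
  | one => intro s hs; simp [onsagerC]; omega
  | more r h1 h2 =>
    intro s hs
    rw [onsagerC, h1 s (by omega), h2 (s - 1) (by omega)]
    simp

lemma aux_main (h e f x y : L) (a : ℤ) (hef : ⁅e, f⁆ = h) (he : ⁅h, e⁆ = (2 : ℂ) • e)
    (hf : ⁅h, f⁆ = -((2 : ℂ) • f)) (hx : ⁅h, x⁆ = (a : ℂ) • x) (hy : ⁅h, y⁆ = -((a : ℂ) • y))
    (hfx : ⁅f, x⁆ = 0) (hey : ⁅e, y⁆ = 0) (r : ℕ) :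
    ∑ s ∈ Finset.range (r + 1),
        (onsagerC a r s : ℂ) • ((LieAlgebra.ad ℂ L (e - f)) ^ s) (x - y) =
      ((LieAlgebra.ad ℂ L e) ^ r) x - ((-1 : ℂ) ^ r) • ((LieAlgebra.ad ℂ L f) ^ r) y := by
  have hfe : ⁅f, e⁆ = -h := by rw [← hef, lie_skew]
  induction r using Nat.twoStepInduction with
  | zero => simp [onsagerC]
  | one =>
    simp [onsagerC, hfx, hey]
  | more r h1 h2 =>
    have E := aux_f h e f x a 1 hfe (by simpa using he) (by simpa using hx) hfx r
    have F := aux_f (-h) f e y a 1 (by simpa using hef) (by simp [hf])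
      (by simp [hy]) hey r
    have key : ∑ s ∈ Finset.range (r + 2 + 1),
        (onsagerC a (r + 2) s : ℂ) • ((LieAlgebra.ad ℂ L (e - f)) ^ s) (x - y) =
      LieAlgebra.ad ℂ L (e - f) (∑ s ∈ Finset.range (r + 1 + 1),
        (onsagerC a (r + 1) s : ℂ) • ((LieAlgebra.ad ℂ L (e - f)) ^ s) (x - y)) -
      (((r : ℂ) + 1) * (r + a)) • ∑ s ∈ Finset.range (r + 1),
        (onsagerC a r s : ℂ) • ((LieAlgebra.ad ℂ L (e - f)) ^ s) (x - y) := by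
      have e1 : ∑ s ∈ Finset.range (r + 1),
          (onsagerC a r s : ℂ) • ((LieAlgebra.ad ℂ L (e - f)) ^ s) (x - y) =
          ∑ s ∈ Finset.range (r + 2 + 1),
          (onsagerC a r s : ℂ) • ((LieAlgebra.ad ℂ L (e - f)) ^ s) (x - y) := by
        rw [Finset.sum_range_succ _ (r + 2), Finset.sum_range_succ _ (r + 1),
          aux_zero a r (r + 1) (by omega), aux_zero a r (r + 2) (by omega)]
        simp
      have e2 : LieAlgebra.ad ℂ L (e - f) (∑ s ∈ Finset.range (r + 1 + 1),
        (onsagerC a (r + 1) s : ℂ) • ((LieAlgebra.ad ℂ L (e - f)) ^ s) (x - y)) =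
          ∑ s ∈ Finset.range (r + 2 + 1),
          ((if s = 0 then 0 else onsagerC a (r + 1) (s - 1) : ℤ) : ℂ) •
            ((LieAlgebra.ad ℂ L (e - f)) ^ s) (x - y) := by
        rw [Finset.sum_range_succ' _ (r + 2), map_sum]
        simp only [map_smul, ← Module.End.mul_apply, ← pow_succ']
        simp
      rw [e1, e2, Finset.smul_sum, ← Finset.sum_sub_distrib]
      refine Finset.sum_congr rfl fun s _ => ?_
      rw [onsagerC, smul_smul, ← sub_smul]
      push_cast
      rfl
    rw [key, h1, h2]
    have hE : ∀ (z w : L), ((LieAlgebra.ad ℂ L z) ^ (r + 2)) w =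
        ⁅z, ((LieAlgebra.ad ℂ L z) ^ (r + 1)) w⁆ := fun z w => by
      rw [pow_succ' _ (r + 1), Module.End.mul_apply, LieAlgebra.ad_apply]
    rw [hE, hE, LieAlgebra.ad_apply, sub_lie, lie_sub, lie_sub, lie_smul, lie_smul, E, F]
    module

end Aux

open KacMoody in
lemma aux_rel {n : ℕ} (A : GCM n) (x : FL n) (hx : x ∈ relations A) :
    (LieSubmodule.Quotient.mk (N := relIdeal A) x : KM A) = 0 :=
  (LieSubmodule.Quotient.mk_eq_zero (relIdeal A)).2 (LieSubmodule.subset_lieSpan hx)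

open KacMoody in
/-- In `g(A)`, with `Y i = e i - f i`, for `i ≠ j` and every `r ≥ 0`:
`Σ_{s=0}^{r} c_s^{ij}[r] (ad (Y i))^s (Y j) = (ad (e i))^r (e j) + (-1)^{r-1} (ad (f i))^r (f j)`.
(We write `(-1)^{r-1} = -(-1)^r` to accommodate `r = 0`.) -/
theorem sum_c_ad_Y {n : ℕ} (A : GCM n) (i j : Fin n) (hij : i ≠ j) (r : ℕ) :
    ∑ s ∈ Finset.range (r + 1),
        (onsagerC (A.a i j) r s : ℂ) • ((LieAlgebra.ad ℂ (KM A) (Y A i)) ^ s) (Y A j) =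
      ((LieAlgebra.ad ℂ (KM A) (e A i)) ^ r) (e A j) -
        ((-1 : ℂ) ^ r) • ((LieAlgebra.ad ℂ (KM A) (f A i)) ^ r) (f A j) := by
  have hHE : ∀ k l, ⁅h A k, e A l⁆ = (A.a k l : ℂ) • e A l := fun k l => by
    have := aux_rel A (⁅Hf k, Ef l⁆ - (A.a k l : ℂ) • Ef l)
      (Or.inl (Or.inl (Or.inl (Or.inl (Or.inr ⟨(k, l), rfl⟩)))))
    have h2 : ⁅h A k, e A l⁆ - (A.a k l : ℂ) • e A l = 0 := by
      rw [← this]; rfl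
    exact sub_eq_zero.1 h2
  have hHF : ∀ k l, ⁅h A k, f A l⁆ = -((A.a k l : ℂ) • f A l) := fun k l => by
    have := aux_rel A (⁅Hf k, Ff l⁆ + (A.a k l : ℂ) • Ff l)
      (Or.inl (Or.inl (Or.inl (Or.inr ⟨(k, l), rfl⟩))))
    have h2 : ⁅h A k, f A l⁆ + (A.a k l : ℂ) • f A l = 0 := by
      rw [← this]; rfl
    exact eq_neg_of_add_eq_zero_left h2
  have hEF : ∀ k l, ⁅e A k, f A l⁆ = if k = l then h A k else 0 := fun k l => by
    have := aux_rel A (⁅Ef k, Ff l⁆ - if k = l then Hf k else 0)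
      (Or.inl (Or.inl (Or.inr ⟨(k, l), rfl⟩)))
    have h2 : ⁅e A k, f A l⁆ - (if k = l then h A k else 0) = 0 := by
      refine Eq.trans ?_ this; split_ifs <;> rfl
    exact sub_eq_zero.1 h2
  refine aux_main (h A i) (e A i) (f A i) (e A j) (f A j) (A.a i j) ?_ ?_ ?_ ?_ ?_ ?_ ?_ r
  · simp [hEF]
  · rw [hHE, A.diag]; norm_num
  · rw [hHF, A.diag]; norm_num
  · exact hHE i j
  · exact hHF i j
  · rw [← lie_skew, hEF, if_neg hij.symm, neg_zero]
  · rw [hEF, if_neg hij]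
end

section
/- In the derived Kac–Moody algebra g(A) of a symmetrizable generalized Cartan matrix A, with Y_i := e_i − f_i, the inhomogeneous Serre relations Σ_{s=0}^{1−a_{ij}} c_s^{ij}[1−a_{ij}] (ad Y_i)^s Y_j = 0 hold for all 1 ≤ i ≠ j ≤ n. -/
theorem onsager_sum_aux {V : Type*} [AddCommGroup V] [Module ℂ V] (T : Module.End ℂ V) (a : ℤ)
    (v : ℕ → V) (h1 : v 1 = T (v 0))
    (h2 : ∀ r : ℕ, v (r + 2) = T (v (r + 1)) - (((r : ℂ) + 1) * ((r : ℂ) + (a : ℂ))) • v r) :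
    ∀ r N : ℕ, r < N →
      ∑ s ∈ Finset.range N, (onsagerC a r s : ℂ) • (T ^ s) (v 0) = v r
  | 0, N, hN => by
      rw [Finset.sum_eq_single_of_mem 0 (Finset.mem_range.2 hN)]
      · simp [onsagerC]
      · intro b _ hb
        simp [onsagerC, hb]
  | 1, N, hN => by
      rw [Finset.sum_eq_single_of_mem 1 (Finset.mem_range.2 hN)]
      · simp [onsagerC, h1]
      · intro b _ hb
        simp [onsagerC, hb]
  | (r + 2), N, hN => by
      obtain ⟨M, rfl⟩ : ∃ M, N = M + 1 := ⟨N - 1, by omega⟩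
      have ih1 := onsager_sum_aux T a v h1 h2 (r + 1) M (by omega)
      have ih2 := onsager_sum_aux T a v h1 h2 r (M + 1) (by omega)
      have key : ∀ s : ℕ, (onsagerC a (r + 2) s : ℂ) • (T ^ s) (v 0) =
          (if s = 0 then (0 : ℂ) else (onsagerC a (r + 1) (s - 1) : ℂ)) • (T ^ s) (v 0) -
          (((r : ℂ) + 1) * ((r : ℂ) + (a : ℂ))) • ((onsagerC a r s : ℂ) • (T ^ s) (v 0)) := by
        intro s
        rw [smul_smul, ← sub_smul]
        congr 1
        rw [onsagerC]
        split_ifs <;> push_cast <;> ring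
      rw [Finset.sum_congr rfl (fun s _ => key s), Finset.sum_sub_distrib, ← Finset.smul_sum, ih2,
        h2 r, Finset.sum_range_succ', ← ih1, map_sum]
      simp [pow_succ']

theorem onsager_lie_aux {L : Type*} [LieRing L] [LieAlgebra ℂ L] (a : ℤ) (e f h x : L)
    (hef : ⁅e, f⁆ = h) (hhe : ⁅h, e⁆ = (2 : ℂ) • e) (hfx : ⁅f, x⁆ = 0)
    (hhx : ⁅h, x⁆ = (a : ℂ) • x) (r : ℕ) :
    ∑ s ∈ Finset.range (r + 1), (onsagerC a r s : ℂ) • ((LieAlgebra.ad ℂ L (e - f)) ^ s) x =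
      ((LieAlgebra.ad ℂ L e) ^ r) x := by
  set v : ℕ → L := fun r => ((LieAlgebra.ad ℂ L e) ^ r) x with hv
  have v0 : v 0 = x := by simp [hv]
  have vs : ∀ r, v (r + 1) = ⁅e, v r⁆ := fun r => by simp [hv, pow_succ']
  have hH : ∀ r : ℕ, ⁅h, v r⁆ = ((a : ℂ) + 2 * r) • v r := by
    intro r
    induction r with
    | zero => simp [v0, hhx]
    | succ r ih =>
      rw [vs, leibniz_lie, hhe, ih, smul_lie, lie_smul, ← add_smul]
      congr 1
      push_cast
      ring
  have hF : ∀ r : ℕ, ⁅f, v (r + 1)⁆ = (-(((r : ℂ) + 1) * ((r : ℂ) + (a : ℂ)))) • v r := by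
    intro r
    have hfe : ⁅f, e⁆ = -h := by rw [← hef, lie_skew]
    induction r with
    | zero =>
      rw [vs, leibniz_lie, hfe, neg_lie, hH, v0, hfx]
      simp
    | succ r ih =>
      rw [vs (r + 1), leibniz_lie, hfe, neg_lie, hH, ih, lie_smul, ← vs, ← neg_smul, ← add_smul]
      congr 1
      push_cast
      ring
  have := onsager_sum_aux (LieAlgebra.ad ℂ L (e - f)) a v
    (by simp [vs 0, v0, hfx])
    (by
      intro r
      rw [LieAlgebra.ad_apply, sub_lie, hF, vs (r + 1), neg_smul]
      abel) r (r + 1) (by omega)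
  rw [v0] at this
  exact this

namespace KacMoody

theorem mk_rel {n : ℕ} (A : GCM n) {x : FL n} (hx : x ∈ relations A) :
    (LieSubmodule.Quotient.mk (N := relIdeal A) x : KM A) = 0 :=
  (LieSubmodule.Quotient.mk_eq_zero').2 (LieSubmodule.subset_lieSpan hx)

theorem rel_he {n : ℕ} (A : GCM n) (i j : Fin n) :
    ⁅h A i, e A j⁆ = (A.a i j : ℂ) • e A j :=
  sub_eq_zero.1 (mk_rel A (Or.inl (Or.inl (Or.inl (Or.inl (Or.inr ⟨(i, j), rfl⟩))))))

theorem rel_hf {n : ℕ} (A : GCM n) (i j : Fin n) :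
    ⁅h A i, f A j⁆ = -((A.a i j : ℂ) • f A j) :=
  eq_neg_of_add_eq_zero_left
    (mk_rel A (Or.inl (Or.inl (Or.inl (Or.inr ⟨(i, j), rfl⟩)))))

theorem rel_ef_same {n : ℕ} (A : GCM n) (i : Fin n) : ⁅e A i, f A i⁆ = h A i := by
  have : ⁅Ef i, Ff i⁆ - Hf i ∈ relations A :=
    Or.inl (Or.inl (Or.inr ⟨(i, i), by simp⟩))
  exact sub_eq_zero.1 (mk_rel A this)

theorem rel_ef_ne {n : ℕ} (A : GCM n) (i j : Fin n) (hij : i ≠ j) : ⁅e A i, f A j⁆ = 0 := by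
  have : ⁅Ef i, Ff j⁆ ∈ relations A :=
    Or.inl (Or.inl (Or.inr ⟨(i, j), by simp [hij]⟩))
  exact mk_rel A this

theorem mk_ad_pow {n : ℕ} (A : GCM n) (x y : FL n) (r : ℕ) :
    (LieSubmodule.Quotient.mk (N := relIdeal A) (((LieAlgebra.ad ℂ (FL n) x) ^ r) y) : KM A) =
      ((LieAlgebra.ad ℂ (KM A) (LieSubmodule.Quotient.mk (N := relIdeal A) x)) ^ r)
        (LieSubmodule.Quotient.mk (N := relIdeal A) y) := by
  induction r with
  | zero => simp
  | succ r ih =>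
    rw [pow_succ', pow_succ', Module.End.mul_apply, Module.End.mul_apply, ← ih]
    rfl

theorem rel_serre_e {n : ℕ} (A : GCM n) (i j : Fin n) (hij : i ≠ j) :
    ((LieAlgebra.ad ℂ (KM A) (e A i)) ^ (1 - A.a i j).toNat) (e A j) = 0 := by
  rw [e, e, ← mk_ad_pow]
  exact mk_rel A (Or.inl (Or.inr ⟨i, j, hij, rfl⟩))

theorem rel_serre_f {n : ℕ} (A : GCM n) (i j : Fin n) (hij : i ≠ j) :
    ((LieAlgebra.ad ℂ (KM A) (f A i)) ^ (1 - A.a i j).toNat) (f A j) = 0 := by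
  rw [f, f, ← mk_ad_pow]
  exact mk_rel A (Or.inr ⟨i, j, hij, rfl⟩)

end KacMoody

open KacMoody in
/-- In `g(A)`, with `Y i = e i - f i`, the inhomogeneous Serre relations
`Σ_{s=0}^{1-a_{ij}} c_s^{ij}[1-a_{ij}] (ad (Y i))^s (Y j) = 0` hold for all `i ≠ j`. -/
theorem inhomogeneous_serre_relations {n : ℕ} (A : GCM n) (i j : Fin n) (hij : i ≠ j) :
    ∑ s ∈ Finset.range ((1 - A.a i j).toNat + 1),
        (onsagerC (A.a i j) (1 - A.a i j).toNat s : ℂ) •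
          ((LieAlgebra.ad ℂ (KM A) (Y A i)) ^ s) (Y A j) = 0 := by
  have he := onsager_lie_aux (A.a i j) (e A i) (f A i) (h A i) (e A j) (rel_ef_same A i)
    (by rw [rel_he, A.diag]; norm_num)
    (by rw [← lie_skew, rel_ef_ne A j i hij.symm, neg_zero]) (rel_he A i j) (1 - A.a i j).toNat
  have hf := onsager_lie_aux (A.a i j) (-f A i) (-e A i) (-h A i) (f A j)
    (by rw [neg_lie, lie_neg, neg_neg, ← lie_skew, rel_ef_same])
    (by rw [neg_lie, lie_neg, neg_neg, rel_hf, A.diag, smul_neg]; norm_num)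
    (by rw [neg_lie, rel_ef_ne A i j hij, neg_zero])
    (by rw [neg_lie, rel_hf, neg_neg]) (1 - A.a i j).toNat
  rw [rel_serre_e A i j hij] at he
  have hneg : -f A i - -e A i = Y A i := by rw [Y]; abel
  rw [hneg, map_neg, neg_pow, Module.End.mul_apply, rel_serre_f A i j hij, map_zero] at hf
  have hY : Y A j = e A j - f A j := rfl
  rw [hY]
  simp only [map_sub, smul_sub, Finset.sum_sub_distrib]
  rw [hf, sub_zero]
  exact he
end

section
/- Let A be a symmetrizable generalized Cartan matrix, g(A) the derived Kac–Moody algebra, ω its Chevalley involution, k(A) the fixed-point Lie subalgebra, and L(A) the generalized Onsager algebra. Then the Lie algebra homomorphism ψ: L(A) → g(A) determined by ψ(B_i) = Y_i := e_i − f_i (1 ≤ i ≤ n) is injective and its image equals k(A); in other words, ψ defines a Lie algebra isomorphism L(A) ≅ k(A). -/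
/-! Preamble: the generalized Onsager algebra `L(A)`, presented by generators `B i`
and the inhomogeneous Serre relations. -/

namespace Onsager

variable {n : ℕ}

/-- The free Lie algebra over `ℂ` on the generators `B 1, …, B n`. -/
abbrev OFL (n : ℕ) : Type := FreeLieAlgebra ℂ (Fin n)

noncomputable def Bf (i : Fin n) : OFL n := FreeLieAlgebra.of ℂ i

/-- The inhomogeneous Serre relations
`Σ_{s=0}^{1-a_{ij}} c_s^{ij}[1-a_{ij}] (ad B_i)^s B_j` for `i ≠ j`. -/
noncomputable def relations (a : Fin n → Fin n → ℤ) : Set (OFL n) :=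
  {x | ∃ i j : Fin n, i ≠ j ∧
    x = ∑ s ∈ Finset.range ((1 - a i j).toNat + 1),
      (onsagerC (a i j) (1 - a i j).toNat s : ℂ) •
        ((LieAlgebra.ad ℂ (OFL n) (Bf i)) ^ s) (Bf j)}

noncomputable def relIdeal (a : Fin n → Fin n → ℤ) : LieIdeal ℂ (OFL n) :=
  LieSubmodule.lieSpan ℂ (OFL n) (relations a)

/-- The generalized Onsager algebra `L(A)`. -/
abbrev OnsagerAlg (a : Fin n → Fin n → ℤ) : Type := OFL n ⧸ relIdeal a

/-- The generators `B i` of `L(A)`. -/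
noncomputable def B (a : Fin n → Fin n → ℤ) (i : Fin n) : OnsagerAlg a :=
  LieSubmodule.Quotient.mk (N := relIdeal a) (Bf i)

end Onsager

namespace OnsagerProof

/-! ### Generation of free Lie algebras -/

lemma free_sub {X : Type*} (K : LieSubalgebra ℂ (FreeLieAlgebra ℂ X))
    (h0 : ∀ i, FreeLieAlgebra.of ℂ i ∈ K) (x : FreeLieAlgebra ℂ X) : x ∈ K := by
  let g : FreeLieAlgebra ℂ X →ₗ⁅ℂ⁆ K :=
    FreeLieAlgebra.lift ℂ (fun i => (⟨FreeLieAlgebra.of ℂ i, h0 i⟩ : K))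
  have hg : K.incl.comp g = LieHom.id := by
    apply FreeLieAlgebra.hom_ext
    intro i
    simp [g]
  have : K.incl (g x) = x := by
    rw [← LieHom.comp_apply, hg]; rfl
  rw [← this]
  exact (g x).2

/-- A submodule stable under bracketing with the generators is stable under all brackets. -/
lemma free_stable {X : Type*} {M : Type*} [AddCommGroup M] [Module ℂ M]
    [LieRingModule (FreeLieAlgebra ℂ X) M] [LieModule ℂ (FreeLieAlgebra ℂ X) M]
    (S : Submodule ℂ M)
    (h1 : ∀ i : X, ∀ x ∈ S, ⁅FreeLieAlgebra.of ℂ i, x⁆ ∈ S) (y : FreeLieAlgebra ℂ X) :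
    ∀ x ∈ S, ⁅y, x⁆ ∈ S := by
  let K : LieSubalgebra ℂ (FreeLieAlgebra ℂ X) :=
    { carrier := {y | ∀ x ∈ S, ⁅y, x⁆ ∈ S}
      add_mem' := by
        intro a b ha hb x hx
        rw [add_lie]; exact S.add_mem (ha x hx) (hb x hx)
      zero_mem' := by
        intro x _
        simp
      smul_mem' := by
        intro c a ha x hx
        rw [smul_lie]; exact S.smul_mem _ (ha x hx)
      lie_mem' := by
        intro a b ha hb x hx
        rw [lie_lie]
        exact S.sub_mem (ha _ (hb x hx)) (hb _ (ha x hx)) }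
  exact free_sub K h1 y

lemma free_gen {X : Type*} (S : Submodule ℂ (FreeLieAlgebra ℂ X))
    (h0 : ∀ i, FreeLieAlgebra.of ℂ i ∈ S)
    (h1 : ∀ i : X, ∀ x ∈ S, ⁅FreeLieAlgebra.of ℂ i, x⁆ ∈ S) (x : FreeLieAlgebra ℂ X) : x ∈ S := by
  let K : LieSubalgebra ℂ (FreeLieAlgebra ℂ X) :=
    { S with
      lie_mem' := by
        intro a b _ hb
        exact free_stable S h1 a b hb }
  exact free_sub K h0 x

/-! ### Chevalley relations in an arbitrary Lie algebra -/

/-- The Chevalley relations other than `[h,h] = 0` and the Serre relations. -/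
structure CR {n : ℕ} (A : GCM n) {L : Type*} [LieRing L] [LieAlgebra ℂ L]
    (e f h : Fin n → L) : Prop where
  he : ∀ i j, ⁅h i, e j⁆ = (A.a i j : ℂ) • e j
  hf : ∀ i j, ⁅h i, f j⁆ = -((A.a i j : ℂ) • f j)
  ef : ∀ i j, ⁅e i, f j⁆ = if i = j then h i else 0

section CRsec

variable {n : ℕ} {A : GCM n} {L : Type*} [LieRing L] [LieAlgebra ℂ L] {e f h : Fin n → L}

lemma CR.swap (H : CR A e f h) : CR A f e (fun i => - h i) where
  he i j := by rw [neg_lie, H.hf, neg_neg]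
  hf i j := by rw [neg_lie, H.he]
  ef i j := by
    rw [← lie_skew, H.ef]
    by_cases hij : i = j
    · subst hij; simp
    · simp [hij, Ne.symm hij]

/-- The iterated bracket `(ad e_i)^r e_j`. -/
noncomputable def U (e : Fin n → L) (i j : Fin n) (r : ℕ) : L :=
  ((LieAlgebra.ad ℂ L (e i)) ^ r) (e j)

lemma U_zero (e : Fin n → L) (i j : Fin n) : U e i j 0 = e j := by simp [U]

lemma U_succ (e : Fin n → L) (i j : Fin n) (r : ℕ) : U e i j (r + 1) = ⁅e i, U e i j r⁆ := by
  simp [U, pow_succ']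

lemma CR.hU (H : CR A e f h) (i j : Fin n) (r : ℕ) :
    ⁅h i, U e i j r⁆ = ((A.a i j : ℂ) + 2 * r) • U e i j r := by
  induction r with
  | zero => simp [U_zero, H.he]
  | succ r ih =>
    rw [U_succ, leibniz_lie, ih, H.he, A.diag, lie_smul, smul_lie, ← add_smul]
    congr 1
    push_cast
    ring

lemma CR.hU' (H : CR A e f h) (k i j : Fin n) (r : ℕ) :
    ∃ c : ℂ, ⁅h k, U e i j r⁆ = c • U e i j r := by
  induction r with
  | zero => exact ⟨_, by rw [U_zero]; exact H.he k j⟩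
  | succ r ih =>
    obtain ⟨c, hc⟩ := ih
    refine ⟨(A.a k i : ℂ) + c, ?_⟩
    rw [U_succ, leibniz_lie, hc, H.he, smul_lie, lie_smul, add_smul]

lemma CR.fU0 (H : CR A e f h) {i j : Fin n} (hij : i ≠ j) : ⁅f i, U e i j 0⁆ = 0 := by
  rw [U_zero, ← lie_skew, H.ef]
  simp [Ne.symm hij]

lemma CR.fU (H : CR A e f h) {i j : Fin n} (hij : i ≠ j) (r : ℕ) :
    ⁅f i, U e i j (r + 1)⁆ = -((((r : ℂ) + 1) * (r + (A.a i j : ℂ))) • U e i j r) := by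
  have hfe : ⁅f i, e i⁆ = - h i := by
    rw [← lie_skew, H.ef]; simp
  induction r with
  | zero =>
    rw [U_succ, leibniz_lie, H.fU0 hij, hfe, neg_lie, H.hU]
    simp
  | succ r ih =>
    rw [U_succ, leibniz_lie, ih, hfe, neg_lie, H.hU, lie_neg, lie_smul, ← U_succ, ← neg_add,
      ← add_smul]
    congr 2
    push_cast
    ring

lemma toNat_one_sub (A : GCM n) {i j : Fin n} (hij : i ≠ j) :
    ∃ m : ℕ, (1 - A.a i j).toNat = m + 1 ∧ A.a i j = -(m : ℤ) := by
  have := A.off_nonpos i j hij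
  exact ⟨(- A.a i j).toNat, by omega, by omega⟩

/-- The Serre element commutes with all `f k`. -/
lemma CR.f_serre (H : CR A e f h) {i j : Fin n} (hij : i ≠ j) (k : Fin n) :
    ⁅f k, U e i j (1 - A.a i j).toNat⁆ = 0 := by
  obtain ⟨m, hm, ha⟩ := toNat_one_sub A hij
  rw [hm]
  by_cases hki : k = i
  · subst hki
    rw [H.fU hij, ha]
    simp
  · have hfe : ⁅f k, e i⁆ = 0 := by
      rw [← lie_skew, H.ef]; simp [Ne.symm hki]
    have key : ∀ r, ⁅f k, U e i j r⁆ =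
        ((LieAlgebra.ad ℂ L (e i)) ^ r) ⁅f k, e j⁆ := by
      intro r
      induction r with
      | zero => simp [U_zero]
      | succ r ih =>
        rw [U_succ, leibniz_lie, ih, hfe, pow_succ']
        simp
    rw [key]
    by_cases hkj : k = j
    · subst hkj
      have hfe' : ⁅f k, e k⁆ = - h k := by
        rw [← lie_skew, H.ef]; simp
      have h1 : ⁅e i, h k⁆ = - ((A.a k i : ℂ) • e i) := by
        rw [← lie_skew, H.he]
      rw [hfe', pow_succ]
      rcases m with _ | m
      · have : A.a k i = 0 := (A.zero_iff i k).1 (by simpa using ha)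
        simp [h1, this]
      · rw [pow_succ]
        simp [h1]
    · have : ⁅f k, e j⁆ = 0 := by
        rw [← lie_skew, H.ef]; simp [Ne.symm hkj]
      rw [this]; simp

/-! ### The inhomogeneous Serre relations hold for `e - f` -/

lemma onsagerC_gt (a : ℤ) : ∀ r s : ℕ, r < s → onsagerC a r s = 0
  | 0, s, hs => by simp [onsagerC]; omega
  | 1, s, hs => by simp [onsagerC]; omega
  | r + 2, s, hs => by
    have h0 : s ≠ 0 := by omega
    rw [onsagerC, onsagerC_gt a r s (by omega), onsagerC_gt a (r + 1) (s - 1) (by omega)]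
    simp

lemma onsagerC_self (a : ℤ) : ∀ r : ℕ, onsagerC a r r = 1
  | 0 => by simp [onsagerC]
  | 1 => by simp [onsagerC]
  | r + 2 => by
    rw [onsagerC, onsagerC_gt a r (r + 2) (by omega)]
    have := onsagerC_self a (r + 1)
    simpa using this

/-- The polynomial expression of the inhomogeneous Serre relation. -/
noncomputable def P (a : ℤ) (r : ℕ) (y x : L) : L :=
  ∑ s ∈ Finset.range (r + 1), (onsagerC a r s : ℂ) • ((LieAlgebra.ad ℂ L y) ^ s) x

lemma P_succ (a : ℤ) (r : ℕ) (y x : L) :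
    P a (r + 2) y x = ⁅y, P a (r + 1) y x⁆ -
      (((r : ℂ) + 1) * (r + (a : ℂ))) • P a r y x := by
  have h1 : P a r y x = ∑ s ∈ Finset.range (r + 2 + 1),
      (onsagerC a r s : ℂ) • ((LieAlgebra.ad ℂ L y) ^ s) x := by
    unfold P
    rw [Finset.sum_range_succ _ (r + 2), Finset.sum_range_succ _ (r + 1),
      onsagerC_gt a r (r + 1) (by omega), onsagerC_gt a r (r + 2) (by omega)]
    simp
  have h2 : ⁅y, P a (r + 1) y x⁆ = ∑ s ∈ Finset.range (r + 2 + 1),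
      ((if s = 0 then 0 else onsagerC a (r + 1) (s - 1) : ℤ) : ℂ) •
        ((LieAlgebra.ad ℂ L y) ^ s) x := by
    rw [Finset.sum_range_succ']
    simp [P, pow_succ', lie_sum]
  rw [h1, h2, Finset.smul_sum, ← Finset.sum_sub_distrib]
  unfold P
  refine Finset.sum_congr rfl fun s _ => ?_
  rw [smul_smul, ← sub_smul]
  congr 1
  rw [onsagerC]
  push_cast
  ring

lemma CR.P_eq (H : CR A e f h) {i j : Fin n} (hij : i ≠ j) : ∀ r : ℕ,
    P (A.a i j) r (e i - f i) (e j - f j) = U e i j r - ((-1 : ℂ) ^ r) • U f i j r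
  | 0 => by simp [P, onsagerC, U_zero]
  | 1 => by
    have h1 := H.ef i j
    have h2 := H.ef j i
    rw [if_neg hij] at h1
    rw [if_neg (Ne.symm hij), ← lie_skew, neg_eq_zero] at h2
    simp [P, onsagerC, U_succ, U_zero, h1, h2]
  | r + 2 => by
    rw [P_succ, CR.P_eq H hij r, CR.P_eq H hij (r + 1)]
    have h1 := H.fU hij r
    have h2 := H.swap.fU hij r
    rw [sub_lie, lie_sub, lie_sub, lie_smul, lie_smul, h1, h2, ← U_succ, ← U_succ]
    simp only [pow_succ]
    module

lemma CR.P_serre (H : CR A e f h) {i j : Fin n} (hij : i ≠ j)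
    (h1 : U e i j (1 - A.a i j).toNat = 0) (h2 : U f i j (1 - A.a i j).toNat = 0) :
    P (A.a i j) (1 - A.a i j).toNat (e i - f i) (e j - f j) = 0 := by
  rw [H.P_eq hij, h1, h2]; simp

end CRsec

/-! ### Homomorphisms out of quotients -/

section Quot

variable {F : Type*} [LieRing F] [LieAlgebra ℂ F] {L : Type*} [LieRing L] [LieAlgebra ℂ L]

/-- The quotient map as a Lie algebra homomorphism. -/
def mkHom (I : LieIdeal ℂ F) : F →ₗ⁅ℂ⁆ F ⧸ I where
  toFun x := LieSubmodule.Quotient.mk (N := I) x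
  map_add' _ _ := rfl
  map_smul' _ _ := rfl
  map_lie' := by
    intro x y
    exact LieSubmodule.Quotient.mk_bracket I x y

lemma mkHom_eq_zero (I : LieIdeal ℂ F) (x : F) : mkHom I x = 0 ↔ x ∈ I :=
  LieSubmodule.Quotient.mk_eq_zero'

lemma mkHom_surj (I : LieIdeal ℂ F) (x : F ⧸ I) : ∃ y, mkHom I y = x := by
  obtain ⟨y, hy⟩ := LieSubmodule.Quotient.surjective_mk' I x
  exact ⟨y, hy⟩

/-- Lift of a homomorphism to the quotient. -/
noncomputable def qlift (I : LieIdeal ℂ F) (g : F →ₗ⁅ℂ⁆ L) (hg : ∀ x ∈ I, g x = 0) :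
    F ⧸ I →ₗ⁅ℂ⁆ L :=
  { I.toSubmodule.liftQ (g : F →ₗ[ℂ] L) (fun x hx => by simpa using hg x hx) with
    map_lie' := by
      intro x y
      obtain ⟨x, rfl⟩ := mkHom_surj I x
      obtain ⟨y, rfl⟩ := mkHom_surj I y
      rw [← LieHom.map_lie]
      exact LieHom.map_lie g x y }

lemma qlift_mk (I : LieIdeal ℂ F) (g : F →ₗ⁅ℂ⁆ L) (hg : ∀ x ∈ I, g x = 0) (x : F) :
    qlift I g hg (mkHom I x) = g x := rfl

lemma lieSpan_kills (s : Set F) (g : F →ₗ⁅ℂ⁆ L) (hg : ∀ x ∈ s, g x = 0) :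
    ∀ x ∈ (LieSubmodule.lieSpan ℂ F s : LieIdeal ℂ F), g x = 0 := by
  have : (LieSubmodule.lieSpan ℂ F s : LieIdeal ℂ F) ≤ g.ker := by
    rw [LieSubmodule.lieSpan_le]
    intro x hx
    simpa using hg x hx
  intro x hx
  simpa using this hx

lemma map_adpow (g : F →ₗ⁅ℂ⁆ L) (x y : F) (r : ℕ) :
    g (((LieAlgebra.ad ℂ F x) ^ r) y) = ((LieAlgebra.ad ℂ L (g x)) ^ r) (g y) := by
  induction r with
  | zero => simp
  | succ r ih => simp [pow_succ', ih]

lemma map_U {n : ℕ} (g : F →ₗ⁅ℂ⁆ L) (e : Fin n → F) (i j : Fin n) (r : ℕ) :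
    g (U e i j r) = U (fun k => g (e k)) i j r := map_adpow g _ _ r

lemma map_P (g : F →ₗ⁅ℂ⁆ L) (a : ℤ) (r : ℕ) (x y : F) :
    g (P a r x y) = P a r (g x) (g y) := by
  simp [P, map_adpow]

end Quot

section KMsec

variable {n : ℕ} (A : GCM n)

lemma km_rel {x : KacMoody.FL n} (hx : x ∈ KacMoody.relations A) :
    mkHom (KacMoody.relIdeal A) x = 0 :=
  (mkHom_eq_zero _ _).2 (LieSubmodule.subset_lieSpan hx)

lemma km_CR : CR A (KacMoody.e A) (KacMoody.f A) (KacMoody.h A) where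
  he i j := by
    have := km_rel A (x := ⁅KacMoody.Hf i, KacMoody.Ef j⁆ - (A.a i j : ℂ) • KacMoody.Ef j)
      (Or.inl (Or.inl (Or.inl (Or.inl (Or.inr ⟨(i, j), rfl⟩)))))
    rw [map_sub, LieHom.map_lie, map_smul] at this
    exact sub_eq_zero.1 this
  hf i j := by
    have := km_rel A (x := ⁅KacMoody.Hf i, KacMoody.Ff j⁆ + (A.a i j : ℂ) • KacMoody.Ff j)
      (Or.inl (Or.inl (Or.inl (Or.inr ⟨(i, j), rfl⟩))))
    rw [map_add, LieHom.map_lie, map_smul] at this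
    exact eq_neg_of_add_eq_zero_left this
  ef i j := by
    have := km_rel A (x := ⁅KacMoody.Ef i, KacMoody.Ff j⁆ - if i = j then KacMoody.Hf i else 0)
      (Or.inl (Or.inl (Or.inr ⟨(i, j), rfl⟩)))
    rw [map_sub, LieHom.map_lie] at this
    have h2 := sub_eq_zero.1 this
    by_cases hij : i = j
    · rw [if_pos hij] at h2 ⊢
      exact h2
    · rw [if_neg hij, map_zero] at h2
      rw [if_neg hij]
      exact h2

lemma km_hh (i j : Fin n) : ⁅KacMoody.h A i, KacMoody.h A j⁆ = 0 := by
  have := km_rel A (x := ⁅KacMoody.Hf i, KacMoody.Hf j⁆)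
    (Or.inl (Or.inl (Or.inl (Or.inl (Or.inl ⟨(i, j), rfl⟩)))))
  rw [LieHom.map_lie] at this
  exact this

lemma km_se {i j : Fin n} (hij : i ≠ j) : U (KacMoody.e A) i j (1 - A.a i j).toNat = 0 := by
  have := km_rel A (x := U KacMoody.Ef i j (1 - A.a i j).toNat)
    (Or.inl (Or.inr ⟨i, j, hij, rfl⟩))
  rw [map_U] at this
  exact this

lemma km_sf {i j : Fin n} (hij : i ≠ j) : U (KacMoody.f A) i j (1 - A.a i j).toNat = 0 := by
  have := km_rel A (x := U KacMoody.Ff i j (1 - A.a i j).toNat)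
    (Or.inr ⟨i, j, hij, rfl⟩)
  rw [map_U] at this
  exact this

/-- The homomorphism `F → g(A)` with `b i ↦ Y i`. -/
noncomputable def psiF : Onsager.OFL n →ₗ⁅ℂ⁆ KacMoody.KM A :=
  FreeLieAlgebra.lift ℂ (KacMoody.Y A)

lemma psiF_b (k : Fin n) : psiF A (Onsager.Bf k) = KacMoody.Y A k :=
  FreeLieAlgebra.lift_of_apply _ k

lemma psiF_kills : ∀ x ∈ Onsager.relIdeal A.a, psiF A x = 0 := by
  apply lieSpan_kills
  rintro x ⟨i, j, hij, rfl⟩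
  have := (km_CR A).P_serre hij (km_se A hij) (km_sf A hij)
  have h2 := map_P (psiF A) (A.a i j) (1 - A.a i j).toNat (Onsager.Bf i) (Onsager.Bf j)
  rw [psiF_b, psiF_b] at h2
  exact h2.trans this

lemma psi_exists : ∃ ψ : Onsager.OnsagerAlg A.a →ₗ⁅ℂ⁆ KacMoody.KM A,
    ∀ i, ψ (Onsager.B A.a i) = KacMoody.Y A i :=
  ⟨qlift (Onsager.relIdeal A.a) (psiF A) (psiF_kills A), psiF_b A⟩

end KMsec

/-! ### The lowest weight module on words -/

section Words

attribute [local instance] LieRing.ofAssociativeRing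

variable {n : ℕ}

/-- The vector space with basis the words in `Fin n`. -/
abbrev T (n : ℕ) : Type := List (Fin n) →₀ ℂ

/-- The basis vector of a word. -/
noncomputable def wd (w : List (Fin n)) : T n := Finsupp.single w 1

/-- Linear extension of a map on words. -/
noncomputable def ext {M : Type*} [AddCommGroup M] [Module ℂ M] (g : List (Fin n) → M) :
    T n →ₗ[ℂ] M := Finsupp.linearCombination ℂ g

lemma ext_wd {M : Type*} [AddCommGroup M] [Module ℂ M] (g : List (Fin n) → M)
    (w : List (Fin n)) : ext g (wd w) = g w := by
  simp [ext, wd]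

lemma lin_ext {M : Type*} [AddCommGroup M] [Module ℂ M] {g g' : T n →ₗ[ℂ] M}
    (hg : ∀ w, g (wd w) = g' (wd w)) : g = g' := by
  apply Finsupp.lhom_ext'
  intro w
  ext
  simpa [wd] using hg w

/-- Left multiplication by a letter. -/
noncomputable def eT (i : Fin n) : Module.End ℂ (T n) := ext fun w => wd (i :: w)

/-- The weight of a word. -/
noncomputable def wt (A : GCM n) (k : Fin n) : List (Fin n) → ℂ
  | [] => 0
  | j :: w => (A.a k j : ℂ) + wt A k w

noncomputable def hT (A : GCM n) (k : Fin n) : Module.End ℂ (T n) := ext fun w => wt A k w • wd w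

/-- The lowering operators on words. -/
noncomputable def fw (A : GCM n) (k : Fin n) : List (Fin n) → T n
  | [] => 0
  | j :: w => eT j (fw A k w) - if j = k then hT A k (wd w) else 0

noncomputable def fT (A : GCM n) (k : Fin n) : Module.End ℂ (T n) := ext (fw A k)

lemma eT_wd (i : Fin n) (w) : eT i (wd w) = wd (i :: w) := ext_wd _ _

lemma hT_wd (A : GCM n) (k : Fin n) (w) : hT A k (wd w) = wt A k w • wd w := ext_wd _ _

lemma fT_nil (A : GCM n) (k : Fin n) : fT A k (wd []) = 0 := ext_wd _ _

lemma fT_cons (A : GCM n) (k j : Fin n) (w) : fT A k (wd (j :: w)) =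
    eT j (fT A k (wd w)) - if j = k then hT A k (wd w) else 0 := by
  rw [fT, ext_wd, ext_wd]; rfl

lemma lieEnd {M : Type*} [AddCommGroup M] [Module ℂ M] (x y : Module.End ℂ M) (v : M) :
    ⁅x, y⁆ v = x (y v) - y (x v) := by
  simp [Ring.lie_def]

lemma T_he (A : GCM n) (k j : Fin n) : ⁅hT A k, eT j⁆ = (A.a k j : ℂ) • eT j := by
  apply lin_ext
  intro w
  rw [lieEnd, eT_wd, hT_wd, hT_wd, map_smul, LinearMap.smul_apply, eT_wd, ← sub_smul]
  congr 1
  simp [wt]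

lemma T_ef (A : GCM n) (j k : Fin n) : ⁅eT j, fT A k⁆ = if j = k then hT A j else 0 := by
  apply lin_ext
  intro w
  rw [lieEnd, eT_wd, fT_cons]
  by_cases hjk : j = k
  · subst hjk; simp
  · simp [hjk]

lemma T_hf (A : GCM n) (k l : Fin n) : ⁅hT A k, fT A l⁆ = -((A.a k l : ℂ) • fT A l) := by
  apply lin_ext
  intro w
  induction w with
  | nil => simp [fT_nil, hT_wd]
  | cons j w ih =>
    have he : ∀ v, hT A k (eT j v) = eT j (hT A k v) + (A.a k j : ℂ) • eT j v := by
      intro v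
      have := congrArg (fun g : Module.End ℂ (T n) => g v) (T_he A k j)
      simp only [lieEnd, LinearMap.smul_apply] at this
      rw [← this]; abel
    have ih' : hT A k (fT A l (wd w)) =
        wt A k w • fT A l (wd w) - (A.a k l : ℂ) • fT A l (wd w) := by
      rw [lieEnd, hT_wd, map_smul] at ih
      rw [LinearMap.neg_apply, LinearMap.smul_apply, sub_eq_iff_eq_add] at ih
      rw [ih]; abel
    rw [lieEnd, hT_wd, map_smul, LinearMap.neg_apply, LinearMap.smul_apply, fT_cons, map_sub, he,
      ih', map_sub, map_smul, map_smul]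
    by_cases hjl : j = l
    · subst hjl
      simp only [if_true, hT_wd, map_smul, wt]
      module
    · simp only [hjl, if_false, map_zero, wt]
      module

lemma T_hh (A : GCM n) (k l : Fin n) : ⁅hT A k, hT A l⁆ = 0 := by
  apply lin_ext
  intro w
  simp [hT_wd, smul_smul, mul_comm]

lemma T_CR (A : GCM n) : CR A (L := Module.End ℂ (T n)) eT (fT A) (hT A) :=
  ⟨T_he A, T_hf A, T_ef A⟩

/-- The Serre element in the `f`s acts by zero. -/
lemma T_sf (A : GCM n) {i j : Fin n} (hij : i ≠ j) :
    U (L := Module.End ℂ (T n)) (fT A) i j (1 - A.a i j).toNat = 0 := by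
  have hc := fun k => (T_CR A).swap.f_serre hij k
  apply lin_ext
  intro w
  rw [LinearMap.zero_apply]
  induction w with
  | nil =>
    have : ∀ r, U (L := Module.End ℂ (T n)) (fT A) i j r (wd []) = 0 := by
      intro r
      induction r with
      | zero => rw [U_zero, fT_nil]
      | succ r ih => rw [U_succ, lieEnd, ih, fT_nil]; simp
    exact this _
  | cons k w ih =>
    have := congrArg (fun g : Module.End ℂ (T n) => g (wd w)) (hc k)
    simp only [lieEnd, LinearMap.zero_apply] at this
    rw [ih, map_zero, zero_sub, neg_eq_zero, eT_wd] at this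
    exact this

/-- The Serre element in the `e`s. -/
noncomputable def thT (A : GCM n) (i j : Fin n) : Module.End ℂ (T n) :=
  U (L := Module.End ℂ (T n)) eT i j (1 - A.a i j).toNat

/-- The product of the letters of a word, as an operator. -/
noncomputable def eW (w : List (Fin n)) : Module.End ℂ (T n) := (w.map eT).prod

/-- The Serre submodule. -/
noncomputable def IT (A : GCM n) : Submodule ℂ (T n) :=
  Submodule.span ℂ {x | ∃ (w : List (Fin n)) (i j : Fin n) (y : T n), i ≠ j ∧
    x = eW w (thT A i j y)}

lemma IT_e (A : GCM n) (k : Fin n) : ∀ x ∈ IT A, eT k x ∈ IT A := by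
  intro x hx
  induction hx using Submodule.span_induction with
  | mem x hx =>
    obtain ⟨w, i, j, y, hij, rfl⟩ := hx
    exact Submodule.subset_span ⟨k :: w, i, j, y, hij, by simp [eW]⟩
  | zero => simp
  | add x y _ _ hx hy => rw [map_add]; exact add_mem hx hy
  | smul c x _ hx => rw [map_smul]; exact Submodule.smul_mem _ _ hx

lemma IT_th (A : GCM n) {i j : Fin n} (hij : i ≠ j) (y : T n) : thT A i j y ∈ IT A :=
  Submodule.subset_span ⟨[], i, j, y, hij, by simp [eW]⟩

lemma IT_induct (A : GCM n) (p : Module.End ℂ (T n))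
    (h0 : ∀ i j, i ≠ j → ∀ y, p (thT A i j y) ∈ IT A)
    (h1 : ∀ k, ∀ x ∈ IT A, p x ∈ IT A → p (eT k x) ∈ IT A) : ∀ x ∈ IT A, p x ∈ IT A := by
  intro x hx
  induction hx using Submodule.span_induction with
  | mem x hx =>
    obtain ⟨w, i, j, y, hij, rfl⟩ := hx
    have : eW w (thT A i j y) ∈ IT A ∧ p (eW w (thT A i j y)) ∈ IT A := by
      induction w with
      | nil => exact ⟨by simpa [eW] using IT_th A hij y, by simpa [eW] using h0 i j hij y⟩
      | cons k w ih =>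
        have : eW (k :: w) (thT A i j y) = eT k (eW w (thT A i j y)) := by simp [eW]
        rw [this]
        exact ⟨IT_e A k _ ih.1, h1 k _ ih.1 ih.2⟩
    exact this.2
  | zero => simp
  | add x y _ _ hx hy => rw [map_add]; exact add_mem hx hy
  | smul c x _ hx => rw [map_smul]; exact Submodule.smul_mem _ _ hx

lemma IT_h (A : GCM n) (k : Fin n) : ∀ x ∈ IT A, hT A k x ∈ IT A := by
  apply IT_induct
  · intro i j hij y
    obtain ⟨c, hc⟩ := (T_CR A).hU' k i j (1 - A.a i j).toNat
    have := congrArg (fun g : Module.End ℂ (T n) => g y) hc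
    simp only [lieEnd, LinearMap.smul_apply, sub_eq_iff_eq_add] at this
    unfold thT
    rw [this]
    exact add_mem (Submodule.smul_mem _ _ (IT_th A hij y)) (IT_th A hij _)
  · intro l x hx hp
    have := congrArg (fun g : Module.End ℂ (T n) => g x) (T_he A k l)
    simp only [lieEnd, LinearMap.smul_apply, sub_eq_iff_eq_add] at this
    rw [this]
    exact add_mem (Submodule.smul_mem _ _ (IT_e A l _ hx)) (IT_e A l _ hp)

lemma IT_f (A : GCM n) (k : Fin n) : ∀ x ∈ IT A, fT A k x ∈ IT A := by
  apply IT_induct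
  · intro i j hij y
    have := congrArg (fun g : Module.End ℂ (T n) => g y) ((T_CR A).f_serre hij k)
    simp only [lieEnd, LinearMap.zero_apply, sub_eq_zero] at this
    unfold thT
    rw [this]
    exact IT_th A hij _
  · intro l x hx hp
    have := congrArg (fun g : Module.End ℂ (T n) => g x) (T_ef A l k)
    simp only [lieEnd, sub_eq_iff_eq_add] at this
    rw [sub_eq_iff_eq_add'.1 (sub_eq_iff_eq_add.2 this) |> fun h => (eq_sub_of_add_eq h.symm)]
    refine sub_mem (IT_e A l _ hp) ?_
    by_cases hlk : l = k
    · subst hlk; simpa using IT_h A l x hx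
    · simp [hlk]

/-- The action of the free Lie algebra on words. -/
noncomputable def opT (A : GCM n) : KacMoody.FL n →ₗ⁅ℂ⁆ Module.End ℂ (T n) :=
  FreeLieAlgebra.lift ℂ fun g => match g with
    | KMGen.E i => eT i
    | KMGen.F i => fT A i
    | KMGen.H i => hT A i

lemma opT_E (A : GCM n) (i : Fin n) : opT A (KacMoody.Ef i) = eT i :=
  FreeLieAlgebra.lift_of_apply _ _
lemma opT_F (A : GCM n) (i : Fin n) : opT A (KacMoody.Ff i) = fT A i :=
  FreeLieAlgebra.lift_of_apply _ _
lemma opT_H (A : GCM n) (i : Fin n) : opT A (KacMoody.Hf i) = hT A i :=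
  FreeLieAlgebra.lift_of_apply _ _

lemma opT_stable (A : GCM n) (z : KacMoody.FL n) : ∀ x ∈ IT A, opT A z x ∈ IT A := by
  let K : LieSubalgebra ℂ (KacMoody.FL n) :=
    { carrier := {z | ∀ x ∈ IT A, opT A z x ∈ IT A}
      add_mem' := by
        intro a b ha hb x hx
        rw [map_add]
        exact add_mem (ha x hx) (hb x hx)
      zero_mem' := by
        intro x _
        rw [map_zero]; exact zero_mem _
      smul_mem' := by
        intro c a ha x hx
        rw [map_smul]
        exact Submodule.smul_mem _ _ (ha x hx)
      lie_mem' := by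
        intro a b ha hb x hx
        rw [LieHom.map_lie, lieEnd]
        exact sub_mem (ha _ (hb x hx)) (hb _ (ha x hx)) }
  refine free_sub K ?_ z
  rintro (i | i | i)
  · intro x hx
    exact (opT_E A i) ▸ IT_e A i x hx
  · intro x hx
    exact (opT_F A i) ▸ IT_f A i x hx
  · intro x hx
    exact (opT_H A i) ▸ IT_h A i x hx

/-- Elements of the relation ideal of `g(A)` map words into the Serre submodule. -/
lemma opT_rel (A : GCM n) {z : KacMoody.FL n} (hz : z ∈ KacMoody.relIdeal A) (y : T n) :
    opT A z y ∈ IT A := by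
  let Z : LieIdeal ℂ (KacMoody.FL n) :=
    { carrier := {z | ∀ x, opT A z x ∈ IT A}
      add_mem' := by
        intro a b ha hb x
        rw [map_add]
        exact add_mem (ha x) (hb x)
      zero_mem' := by
        intro x
        rw [map_zero]; exact zero_mem _
      smul_mem' := by
        intro c a ha x
        rw [map_smul]
        exact Submodule.smul_mem _ _ (ha x)
      lie_mem := by
        intro a b hb x
        rw [LieHom.map_lie, lieEnd]
        exact sub_mem (opT_stable A a _ (hb x)) (hb _) }
  have h0 : ∀ z, opT A z = 0 → z ∈ Z := by
    intro z hz x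
    rw [hz]; exact zero_mem _
  have : KacMoody.relIdeal A ≤ Z := by
    unfold KacMoody.relIdeal
    rw [LieSubmodule.lieSpan_le]
    rintro z (((((⟨⟨i, j⟩, rfl⟩ | ⟨⟨i, j⟩, rfl⟩) | ⟨⟨i, j⟩, rfl⟩) | ⟨⟨i, j⟩, rfl⟩) |
      ⟨i, j, hij, rfl⟩) | ⟨i, j, hij, rfl⟩)
    · apply h0
      rw [LieHom.map_lie, opT_H, opT_H, T_hh]
    · apply h0
      rw [map_sub, LieHom.map_lie, map_smul, opT_H, opT_E, T_he, sub_self]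
    · apply h0
      rw [map_add, LieHom.map_lie, map_smul, opT_H, opT_F, T_hf]
      exact neg_add_cancel ((A.a i j : ℂ) • fT A j)
    · apply h0
      rw [map_sub, LieHom.map_lie, opT_E, opT_F, T_ef]
      by_cases hij : i = j
      · simp only [hij, if_true]
        rw [opT_H, sub_self]
      · simp [hij]
    · intro x
      rw [map_adpow, opT_E, opT_E]
      exact IT_th A hij x
    · apply h0
      rw [map_adpow, opT_F, opT_F]
      exact T_sf A hij
  exact this hz y

end Words

/-! ### The free Lie algebra, its degree derivation and the ideal `Kk` -/

section FreeSide

attribute [local instance] LieRing.ofAssociativeRing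

variable {n : ℕ}

open Onsager (OFL Bf)

/-- The affine operator `(c, v) ↦ (0, c d + [x, v])`. -/
noncomputable def Rx (d x : OFL n) : Module.End ℂ (ℂ × OFL n) :=
  LinearMap.prod 0 (LinearMap.coprod (LinearMap.toSpanSingleton ℂ (OFL n) d)
    (LieAlgebra.ad ℂ (OFL n) x : OFL n →ₗ[ℂ] OFL n))

lemma Rx_apply (d x : OFL n) (p : ℂ × OFL n) : Rx d x p = (0, p.1 • d + ⁅x, p.2⁆) := by
  simp [Rx]

/-- The affine representation of the free Lie algebra. -/
noncomputable def rho : OFL n →ₗ⁅ℂ⁆ Module.End ℂ (ℂ × OFL n) :=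
  FreeLieAlgebra.lift ℂ fun i => Rx (Bf i) (Bf i)

lemma rho_b (i : Fin n) : rho (Bf i) = Rx (Bf i) (Bf i) := FreeLieAlgebra.lift_of_apply _ i

/-- The degree derivation. -/
noncomputable def D : Module.End ℂ (OFL n) where
  toFun x := (rho x (1, 0)).2
  map_add' x y := by rw [map_add]; rfl
  map_smul' c x := by rw [map_smul]; rfl

lemma D_def (x : OFL n) : D x = (rho x (1, 0)).2 := rfl

lemma rho_apply (x : OFL n) : ∀ p : ℂ × OFL n, rho x p = (0, p.1 • D x + ⁅x, p.2⁆) := by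
  let K : LieSubalgebra ℂ (OFL n) :=
    { carrier := {x | ∀ p : ℂ × OFL n, rho x p = (0, p.1 • D x + ⁅x, p.2⁆)}
      add_mem' := by
        intro a b ha hb p
        rw [map_add, LinearMap.add_apply, ha, hb, map_add]
        ext
        · simp
        · simp only [Prod.snd_add, add_lie, smul_add]; abel
      zero_mem' := by
        intro p
        rw [map_zero, map_zero]
        ext <;> simp
      smul_mem' := by
        intro c a ha p
        rw [map_smul, LinearMap.smul_apply, ha, map_smul]
        ext
        · simp
        · simp only [Prod.smul_snd, smul_lie, smul_add]
          rw [smul_comm c p.1 (D a)]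
      lie_mem' := by
        intro a b ha hb p
        have h1 : ∀ p : ℂ × OFL n, rho ⁅a, b⁆ p =
            (0, p.1 • (⁅a, D b⁆ - ⁅b, D a⁆) + ⁅⁅a, b⁆, p.2⁆) := by
          intro p
          rw [LieHom.map_lie, lieEnd, hb p, ha p, ha, hb]
          ext
          · simp
          · simp only [Prod.snd_sub, lie_add, lie_smul, lie_lie, smul_sub, zero_smul, zero_add]
            abel
        have h2 : D ⁅a, b⁆ = ⁅a, D b⁆ - ⁅b, D a⁆ := by
          rw [D_def, h1]; simp
        rw [h1, h2] }
  refine free_sub K ?_ x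
  intro i p
  have h1 : rho (FreeLieAlgebra.of ℂ i) = Rx (Bf i) (Bf i) := rho_b i
  rw [D_def, h1, Rx_apply, Rx_apply]
  simp [Bf]

lemma D_b (i : Fin n) : D (Bf i) = Bf i := by
  rw [D_def, rho_b, Rx_apply]; simp

lemma D_lie (x y : OFL n) : D ⁅x, y⁆ = ⁅x, D y⁆ - ⁅y, D x⁆ := by
  rw [D_def, LieHom.map_lie, lieEnd, rho_apply y, rho_apply x, rho_apply, rho_apply]
  simp

/-- The homogeneous component of degree `s`. -/
noncomputable def eig (n s : ℕ) : Submodule ℂ (OFL n) := Module.End.eigenspace D (s : ℂ)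

lemma mem_eig (s : ℕ) (x : OFL n) : x ∈ eig n s ↔ D x = (s : ℂ) • x :=
  Module.End.mem_eigenspace_iff

lemma eig_b (i : Fin n) : Bf i ∈ eig n 1 := by
  rw [mem_eig, D_b]; simp

lemma eig_lie (i : Fin n) {s : ℕ} {x : OFL n} (hx : x ∈ eig n s) : ⁅Bf i, x⁆ ∈ eig n (s + 1) := by
  rw [mem_eig] at *
  rw [D_lie, hx, D_b, lie_smul, ← lie_skew x]
  push_cast
  module

lemma eig_U (i j : Fin n) (r : ℕ) : U (Bf (n := n)) i j r ∈ eig n (r + 1) := by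
  induction r with
  | zero => rw [U_zero]; exact eig_b j
  | succ r ih => rw [U_succ]; exact eig_lie i ih

/-- The intertwiner from words. -/
noncomputable def Del : T n →ₗ[ℂ] ℂ × OFL n :=
  ext fun w => (w.map fun i => rho (Bf i)).prod (1, 0)

lemma Del_nil : Del (wd ([] : List (Fin n))) = (1, 0) := by
  rw [Del, ext_wd]; simp

lemma Del_e (i : Fin n) (y : T n) : Del (eT i y) = rho (Bf i) (Del y) := by
  have : Del ∘ₗ eT i = (rho (Bf i)) ∘ₗ Del := by
    apply lin_ext
    intro w
    rw [LinearMap.comp_apply, LinearMap.comp_apply, eT_wd, Del, ext_wd, ext_wd]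
    simp
  exact congrArg (fun g : T n →ₗ[ℂ] ℂ × OFL n => g y) this

/-- The free Lie algebra acting on words by left multiplication. -/
noncomputable def opE : OFL n →ₗ⁅ℂ⁆ Module.End ℂ (T n) := FreeLieAlgebra.lift ℂ eT

lemma opE_b (i : Fin n) : opE (Bf i) = eT i := FreeLieAlgebra.lift_of_apply _ i

lemma Del_opE (x : OFL n) : ∀ y : T n, Del (opE x y) = rho x (Del y) := by
  let K : LieSubalgebra ℂ (OFL n) :=
    { carrier := {x | ∀ y : T n, Del (opE x y) = rho x (Del y)}
      add_mem' := by
        intro a b ha hb y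
        rw [map_add, map_add, LinearMap.add_apply, LinearMap.add_apply, map_add, ha, hb]
      zero_mem' := by
        intro y
        rw [map_zero, map_zero]; simp
      smul_mem' := by
        intro c a ha y
        rw [map_smul, map_smul, LinearMap.smul_apply, LinearMap.smul_apply, map_smul, ha]
      lie_mem' := by
        intro a b ha hb y
        rw [LieHom.map_lie, LieHom.map_lie, lieEnd, lieEnd, map_sub, ha, hb, hb, ha] }
  refine free_sub K ?_ x
  intro i y
  have := Del_e i y
  rw [← opE_b] at this
  exact this

/-- The left-normed bracket of a word. -/
noncomputable def bw (w : List (Fin n)) : OFL n := (Del (wd w)).2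

lemma bw_nil : bw ([] : List (Fin n)) = 0 := by rw [bw, Del_nil]

lemma Del_cons (i : Fin n) (w : List (Fin n)) : Del (wd (i :: w)) =
    (0, (Del (wd w)).1 • Bf i + ⁅Bf i, bw w⁆) := by
  rw [← eT_wd, Del_e, rho_b, Rx_apply]; rfl

lemma bw_single (i : Fin n) : bw [i] = Bf i := by
  rw [bw, Del_cons, Del_nil, bw_nil]; simp

lemma bw_cons (i k : Fin n) (w : List (Fin n)) : bw (i :: k :: w) = ⁅Bf i, bw (k :: w)⁆ := by
  rw [bw, Del_cons, Del_cons]; simp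

lemma bw_eig (w : List (Fin n)) : bw w ∈ eig n w.length := by
  induction w with
  | nil => rw [bw_nil]; exact zero_mem _
  | cons i w ih =>
    cases w with
    | nil => rw [bw_single]; exact eig_b i
    | cons k w => rw [bw_cons]; exact eig_lie i ih

/-- The degree filtration on the free Lie algebra. -/
noncomputable def Fle (n r : ℕ) : Submodule ℂ (OFL n) :=
  Submodule.span ℂ {x | ∃ w : List (Fin n), w.length ≤ r ∧ x = bw w}

lemma Fle_mono {r s : ℕ} (h : r ≤ s) : Fle n r ≤ Fle n s := by
  apply Submodule.span_mono
  rintro x ⟨w, hw, rfl⟩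
  exact ⟨w, hw.trans h, rfl⟩

lemma bw_mem {w : List (Fin n)} {r : ℕ} (h : w.length ≤ r) : bw w ∈ Fle n r :=
  Submodule.subset_span ⟨w, h, rfl⟩

lemma Fle_lie (i : Fin n) {r : ℕ} {x : OFL n} (hx : x ∈ Fle n r) : ⁅Bf i, x⁆ ∈ Fle n (r + 1) := by
  induction hx using Submodule.span_induction with
  | mem x hx =>
    obtain ⟨w, hw, rfl⟩ := hx
    cases w with
    | nil => rw [bw_nil, lie_zero]; exact zero_mem _
    | cons k w =>
      rw [← bw_cons]
      exact bw_mem (by simpa using hw)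
  | zero => rw [lie_zero]; exact zero_mem _
  | add x y _ _ hx hy => rw [lie_add]; exact add_mem hx hy
  | smul c x _ hx => rw [lie_smul]; exact Submodule.smul_mem _ _ hx

lemma U_Fle (i j : Fin n) (r : ℕ) : U (Bf (n := n)) i j r ∈ Fle n (r + 1) := by
  induction r with
  | zero =>
    rw [U_zero, ← bw_single]
    exact bw_mem (by simp)
  | succ r ih => rw [U_succ]; exact Fle_lie i ih

lemma Fle_exhaust (x : OFL n) : ∃ r, x ∈ Fle n r := by
  let S : Submodule ℂ (OFL n) :=
    { carrier := {x | ∃ r, x ∈ Fle n r}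
      add_mem' := by
        rintro a b ⟨r, hr⟩ ⟨s, hs⟩
        exact ⟨r + s, add_mem (Fle_mono (by omega) hr) (Fle_mono (by omega) hs)⟩
      zero_mem' := ⟨0, zero_mem _⟩
      smul_mem' := by
        rintro c a ⟨r, hr⟩
        exact ⟨r, Submodule.smul_mem _ _ hr⟩ }
  refine free_gen S ?_ ?_ x
  · intro i
    refine ⟨1, ?_⟩
    have := U_Fle i i 0
    rw [U_zero] at this
    exact this
  · rintro i x ⟨r, hr⟩
    exact ⟨r + 1, Fle_lie i hr⟩

variable (A : GCM n)

/-- The quotient map onto the Onsager algebra. -/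
noncomputable def q : OFL n →ₗ⁅ℂ⁆ Onsager.OnsagerAlg A.a := mkHom (Onsager.relIdeal A.a)

/-- Homogeneous elements of degree `s + 1` whose image has lower filtration degree. -/
noncomputable def Ks (s : ℕ) : Submodule ℂ (OFL n) where
  carrier := {x | x ∈ eig n (s + 1) ∧ ∃ y ∈ Fle n s, q A x = q A y}
  add_mem' := by
    rintro a b ⟨ha, y, hy, h1⟩ ⟨hb, z, hz, h2⟩
    exact ⟨add_mem ha hb, y + z, add_mem hy hz, by rw [map_add, map_add, h1, h2]⟩
  zero_mem' := ⟨zero_mem _, 0, zero_mem _, rfl⟩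
  smul_mem' := by
    rintro c a ⟨ha, y, hy, h1⟩
    exact ⟨Submodule.smul_mem _ _ ha, c • y, Submodule.smul_mem _ _ hy, by
      rw [map_smul, map_smul, h1]⟩

/-- The ideal spanned by all `Ks`. -/
noncomputable def Kk : Submodule ℂ (OFL n) := ⨆ s, Ks A s

lemma Ks_le (s : ℕ) : Ks A s ≤ Kk A := le_iSup (Ks A) s

lemma Kk_b (i : Fin n) (x : OFL n) (hx : x ∈ Kk A) : ⁅Bf i, x⁆ ∈ Kk A := by
  refine Submodule.iSup_induction (Ks A) (motive := fun x => ⁅Bf i, x⁆ ∈ Kk A) hx ?_ ?_ ?_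
  · rintro s x ⟨hx, y, hy, h1⟩
    exact Ks_le A (s + 1) ⟨eig_lie i hx, ⁅Bf i, y⁆, Fle_lie i hy, by
      rw [LieHom.map_lie, LieHom.map_lie, h1]⟩
  · rw [lie_zero]; exact zero_mem _
  · intro x y hx hy
    rw [lie_add]; exact add_mem hx hy

lemma Kk_D (x : OFL n) (hx : x ∈ Kk A) : D x ∈ Kk A := by
  refine Submodule.iSup_induction (Ks A) (motive := fun x => D x ∈ Kk A) hx ?_ ?_ ?_
  · intro s x hx
    rw [(mem_eig _ _).1 hx.1]
    exact Submodule.smul_mem _ _ (Ks_le A s hx)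
  · rw [map_zero]; exact zero_mem _
  · intro x y hx hy
    rw [map_add]; exact add_mem hx hy

lemma Kk_lie (y x : OFL n) (hx : x ∈ Kk A) : ⁅y, x⁆ ∈ Kk A :=
  free_stable (Kk A) (fun i x hx => Kk_b A i x hx) y x hx

lemma Kk_serre {i j : Fin n} (hij : i ≠ j) : U (Bf (n := n)) i j (1 - A.a i j).toNat ∈ Kk A := by
  obtain ⟨m, hm, -⟩ := toNat_one_sub A hij
  have hq : q A (P (A.a i j) (1 - A.a i j).toNat (Bf i) (Bf j)) = 0 :=
    (mkHom_eq_zero _ _).2 (LieSubmodule.subset_lieSpan ⟨i, j, hij, rfl⟩)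
  rw [hm] at hq ⊢
  refine Ks_le A (m + 1) ⟨eig_U i j (m + 1),
    - ∑ s ∈ Finset.range (m + 1), (onsagerC (A.a i j) (m + 1) s : ℂ) • U (Bf (n := n)) i j s,
    ?_, ?_⟩
  · refine neg_mem (Submodule.sum_mem _ fun s hs => Submodule.smul_mem _ _ ?_)
    exact Fle_mono (by have := Finset.mem_range.1 hs; omega) (U_Fle i j s)
  · rw [P, Finset.sum_range_succ, onsagerC_self, map_add] at hq
    rw [map_neg]
    have h2 := eq_neg_of_add_eq_zero_right hq
    simpa [U] using h2

/-- The intertwiner maps the Serre submodule into `Kk`. -/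
lemma Del_IT (x : T n) (hx : x ∈ IT A) : (Del x).1 = 0 ∧ (Del x).2 ∈ Kk A := by
  induction hx using Submodule.span_induction with
  | mem x hx =>
    obtain ⟨w, i, j, y, hij, rfl⟩ := hx
    induction w with
    | nil =>
      have h1 : eW [] (thT A i j y) = opE (U (Bf (n := n)) i j (1 - A.a i j).toNat) y := by
        rw [map_U]
        simp only [opE_b]
        simp [eW, thT]
      rw [h1, Del_opE, rho_apply]
      refine ⟨rfl, add_mem (Submodule.smul_mem _ _ (Kk_D A _ (Kk_serre A hij))) ?_⟩
      rw [← lie_skew]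
      exact neg_mem (Kk_lie A _ _ (Kk_serre A hij))
    | cons k w ih =>
      have : eW (k :: w) (thT A i j y) = eT k (eW w (thT A i j y)) := by simp [eW]
      rw [this, Del_e, rho_b, Rx_apply]
      refine ⟨rfl, ?_⟩
      rw [ih.1, zero_smul, zero_add]
      exact Kk_b A k _ ih.2
  | zero => rw [map_zero]; exact ⟨rfl, zero_mem _⟩
  | add x y _ _ hx hy =>
    rw [map_add]
    exact ⟨by rw [Prod.fst_add, hx.1, hy.1, add_zero], add_mem hx.2 hy.2⟩
  | smul c x _ hx =>
    rw [map_smul]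
    exact ⟨by rw [Prod.smul_fst, hx.1, smul_zero], Submodule.smul_mem _ _ hx.2⟩

/-! ### Filtration on words -/

/-- Span of words of length at most `k`. -/
noncomputable def Tle (n k : ℕ) : Submodule ℂ (T n) :=
  Submodule.span ℂ {x | ∃ w : List (Fin n), w.length ≤ k ∧ x = wd w}

lemma wd_mem {w : List (Fin n)} {r : ℕ} (h : w.length ≤ r) : wd w ∈ Tle n r :=
  Submodule.subset_span ⟨w, h, rfl⟩

lemma Tle_mono {r s : ℕ} (h : r ≤ s) : Tle n r ≤ Tle n s := by
  apply Submodule.span_mono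
  rintro x ⟨w, hw, rfl⟩
  exact ⟨w, hw.trans h, rfl⟩

/-- Operators of filtration degree at most `d`. -/
def Deg (d : ℕ) (g : Module.End ℂ (T n)) : Prop := ∀ k, ∀ x ∈ Tle n k, g x ∈ Tle n (k + d)

lemma Deg_of {d : ℕ} {g : Module.End ℂ (T n)}
    (h : ∀ w : List (Fin n), g (wd w) ∈ Tle n (w.length + d)) : Deg d g := by
  intro k x hx
  induction hx using Submodule.span_induction with
  | mem x hx =>
    obtain ⟨w, hw, rfl⟩ := hx
    exact Tle_mono (by omega) (h w)
  | zero => rw [map_zero]; exact zero_mem _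
  | add x y _ _ hx hy => rw [map_add]; exact add_mem hx hy
  | smul c x _ hx => rw [map_smul]; exact Submodule.smul_mem _ _ hx

lemma Deg.lie {d d' : ℕ} {g g' : Module.End ℂ (T n)} (h : Deg d g) (h' : Deg d' g') :
    Deg (d + d') ⁅g, g'⁆ := by
  intro k x hx
  rw [lieEnd]
  refine sub_mem ?_ ?_
  · exact Tle_mono (by omega) (h _ _ (h' _ _ hx))
  · exact Tle_mono (by omega) (h' _ _ (h _ _ hx))

lemma Deg.mono {d d' : ℕ} (hd : d ≤ d') {g : Module.End ℂ (T n)} (h : Deg d g) : Deg d' g :=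
  fun k x hx => Tle_mono (by omega) (h k x hx)

lemma Deg.sub {d : ℕ} {g g' : Module.End ℂ (T n)} (h : Deg d g) (h' : Deg d g') :
    Deg d (g - g') :=
  fun k x hx => sub_mem (h k x hx) (h' k x hx)

lemma Deg.add {d : ℕ} {g g' : Module.End ℂ (T n)} (h : Deg d g) (h' : Deg d g') :
    Deg d (g + g') :=
  fun k x hx => add_mem (h k x hx) (h' k x hx)

lemma Deg_zero {d : ℕ} : Deg d (0 : Module.End ℂ (T n)) :=
  fun _ _ _ => zero_mem _

lemma Deg_e (i : Fin n) : Deg 1 (eT i) :=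
  Deg_of fun w => by rw [eT_wd]; exact wd_mem (by simp)

lemma Deg_f (i : Fin n) : Deg 0 (fT A i) := by
  apply Deg_of
  intro w
  induction w with
  | nil => rw [fT_nil]; exact zero_mem _
  | cons j w ih =>
    rw [fT_cons]
    refine sub_mem ?_ ?_
    · exact Tle_mono (by simp) (Deg_e j _ _ ih)
    · split_ifs
      · rw [hT_wd]
        exact Submodule.smul_mem _ _ (wd_mem (by simp))
      · exact zero_mem _

/-- The map of free Lie algebras `b i ↦ E i - F i`. -/
noncomputable def tld : OFL n →ₗ⁅ℂ⁆ KacMoody.FL n :=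
  FreeLieAlgebra.lift ℂ fun i => KacMoody.Ef i - KacMoody.Ff i

lemma tld_b (i : Fin n) : tld (Bf i) = KacMoody.Ef i - KacMoody.Ff i :=
  FreeLieAlgebra.lift_of_apply _ i

lemma op_b (i : Fin n) : opT A (tld (Bf i)) = eT i - fT A i := by
  rw [tld_b, map_sub, opT_E, opT_F]

lemma Deg_opE (w : List (Fin n)) : Deg w.length (opE (bw w)) := by
  induction w with
  | nil => rw [bw_nil, map_zero]; exact Deg_zero
  | cons i w ih =>
    cases w with
    | nil => rw [bw_single, opE_b]; exact Deg_e i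
    | cons k w =>
      rw [bw_cons, LieHom.map_lie, opE_b]
      exact ((Deg_e i).lie ih).mono (by simp; omega)

lemma Deg_diff (w : List (Fin n)) :
    Deg (w.length - 1) (opT A (tld (bw w)) - opE (bw w)) := by
  induction w with
  | nil =>
    rw [bw_nil, map_zero, map_zero, map_zero]
    exact Deg_zero.sub Deg_zero
  | cons i w ih =>
    cases w with
    | nil =>
      rw [bw_single, op_b, opE_b]
      intro k x hx
      have := Deg_f A i k x hx
      have h2 : (eT i - fT A i - eT i) x = - fT A i x := by simp
      rw [h2]
      exact neg_mem (Tle_mono (by omega) this)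
    | cons k w =>
      have hu : Deg (k :: w).length (opT A (tld (bw (k :: w)))) := by
        have := (ih.mono (Nat.sub_le _ _)).add (Deg_opE (k :: w))
        intro d x hx
        have h2 := this d x hx
        rwa [LinearMap.add_apply, LinearMap.sub_apply, sub_add_cancel] at h2
      rw [bw_cons, LieHom.map_lie, LieHom.map_lie, LieHom.map_lie, op_b, opE_b]
      set u := opT A (tld (bw (k :: w)))
      set v := opE (bw (k :: w))
      have h3 : ⁅eT i - fT A i, u⁆ - ⁅eT i, v⁆ = ⁅eT i, u - v⁆ - ⁅fT A i, u⁆ := by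
        apply LinearMap.ext
        intro x
        simp only [LinearMap.sub_apply, lieEnd, map_sub]
        abel
      rw [h3]
      refine Deg.sub ?_ ?_
      · exact ((Deg_e i).lie ih).mono (by simp; omega)
      · exact ((Deg_f A i).lie hu).mono (by simp)

lemma Del_Tle {k : ℕ} {x : T n} (hx : x ∈ Tle n k) : (Del x).2 ∈ Fle n k := by
  induction hx using Submodule.span_induction with
  | mem x hx =>
    obtain ⟨w, hw, rfl⟩ := hx
    exact bw_mem hw
  | zero => rw [map_zero]; exact zero_mem _
  | add x y _ _ hx hy => rw [map_add]; exact add_mem hx hy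
  | smul c x _ hx => rw [map_smul]; exact Submodule.smul_mem _ _ hx

/-- The leading term of the action on the lowest weight vector. -/
lemma lead {r : ℕ} {x : OFL n} (hx : x ∈ Fle n (r + 1)) :
    ∃ t ∈ eig n (r + 1), ∃ y ∈ Fle n r, x = t + y ∧
      ∃ z ∈ Fle n r, (Del (opT A (tld x) (wd []))).2 = ((r : ℂ) + 1) • t + z := by
  induction hx using Submodule.span_induction with
  | mem x hx =>
    obtain ⟨w, hw, rfl⟩ := hx
    have h1 := Deg_diff A w 0 (wd []) (wd_mem (by simp))
    have h2 := Del_Tle h1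
    have h3 : (Del (opT A (tld (bw w)) (wd []))).2 =
        D (bw w) + (Del ((opT A (tld (bw w)) - opE (bw w)) (wd []))).2 := by
      rw [LinearMap.sub_apply, map_sub, Prod.snd_sub, Del_opE, Del_nil, rho_apply]
      simp
    have h4 := (mem_eig _ _).1 (bw_eig w)
    rcases Nat.lt_or_eq_of_le hw with hlt | heq
    · refine ⟨0, zero_mem _, bw w, bw_mem (by omega), by simp,
        (Del (opT A (tld (bw w)) (wd []))).2, ?_, by rw [smul_zero, zero_add]⟩
      · rw [h3, h4]
        exact add_mem (Submodule.smul_mem _ _ (bw_mem (by omega))) (Fle_mono (by omega) h2)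
    · refine ⟨bw w, heq ▸ bw_eig w, 0, zero_mem _, by simp, _, Fle_mono (by omega) h2, ?_⟩
      rw [h3, h4, heq]
      push_cast
      rfl
  | zero => exact ⟨0, zero_mem _, 0, zero_mem _, by simp, 0, zero_mem _, by simp⟩
  | add x x' _ _ hx hx' =>
    obtain ⟨t, ht, y, hy, rfl, z, hz, h1⟩ := hx
    obtain ⟨t', ht', y', hy', rfl, z', hz', h1'⟩ := hx'
    refine ⟨t + t', add_mem ht ht', y + y', add_mem hy hy', by abel, z + z', add_mem hz hz', ?_⟩
    rw [map_add, map_add, LinearMap.add_apply, map_add, Prod.snd_add, h1, h1', smul_add]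
    abel
  | smul c x _ hx =>
    obtain ⟨t, ht, y, hy, rfl, z, hz, h1⟩ := hx
    refine ⟨c • t, Submodule.smul_mem _ _ ht, c • y, Submodule.smul_mem _ _ hy, by
      rw [smul_add], c • z, Submodule.smul_mem _ _ hz, ?_⟩
    rw [map_smul, map_smul, LinearMap.smul_apply, map_smul, Prod.smul_snd, h1, smul_add,
      smul_comm]

lemma eig_indep : iSupIndep (eig n) := by
  have := (Module.End.eigenspaces_iSupIndep (D (n := n))).comp (f := fun s : ℕ => (s : ℂ))
    Nat.cast_injective
  exact this

lemma Fle_other (r : ℕ) : Fle n r ≤ ⨆ (s : ℕ) (_ : s ≠ r + 1), eig n s := by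
  apply Submodule.span_le.2
  rintro x ⟨w, hw, rfl⟩
  exact Submodule.mem_iSup_of_mem w.length (Submodule.mem_iSup_of_mem (by omega) (bw_eig w))

lemma Kk_split (r : ℕ) : Kk A ≤ Ks A r ⊔ ⨆ (s : ℕ) (_ : s ≠ r + 1), eig n s := by
  apply iSup_le
  intro s
  by_cases hs : s = r
  · subst hs; exact le_sup_left
  · refine le_trans ?_ le_sup_right
    intro x hx
    exact Submodule.mem_iSup_of_mem (s + 1) (Submodule.mem_iSup_of_mem (by omega) hx.1)

lemma psi_tld (x : OFL n) : psiF A x = mkHom (KacMoody.relIdeal A) (tld x) := by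
  have : psiF A = (mkHom (KacMoody.relIdeal A)).comp tld := by
    apply FreeLieAlgebra.hom_ext
    intro i
    have h1 : psiF A (FreeLieAlgebra.of ℂ i) = KacMoody.Y A i := psiF_b A i
    have h2 : tld (FreeLieAlgebra.of ℂ i) = KacMoody.Ef i - KacMoody.Ff i := tld_b i
    rw [LieHom.comp_apply, h1, h2]
    rfl
  rw [this]; rfl

lemma psi_q {x y : OFL n} (h : q A x = q A y) : psiF A x = psiF A y := by
  have : x - y ∈ Onsager.relIdeal A.a := by
    rw [← mkHom_eq_zero]
    change q A (x - y) = 0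
    rw [map_sub, h, sub_self]
  have h2 := psiF_kills A _ this
  rwa [map_sub, sub_eq_zero] at h2

/-- The descent step. -/
lemma descent (r : ℕ) : ∀ x ∈ Fle n r, psiF A x = 0 → q A x = 0 := by
  induction r with
  | zero =>
    intro x hx _
    have : Fle n 0 ≤ ⊥ := by
      apply Submodule.span_le.2
      rintro x ⟨w, hw, rfl⟩
      have : w = [] := List.length_eq_zero_iff.1 (by omega)
      subst this
      rw [bw_nil]; exact zero_mem _
    rw [(Submodule.mem_bot ℂ).1 (this hx), map_zero]
  | succ r ih =>
    intro x hx hk0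
    have hk : tld x ∈ KacMoody.relIdeal A := by
      rwa [psi_tld, mkHom_eq_zero] at hk0
    obtain ⟨t, ht, y, hy, hxy, z, hz, hD⟩ := lead A hx
    have h1 := (Del_IT A _ (opT_rel A hk (wd []))).2
    rw [hD] at h1
    obtain ⟨k, hk1, o, ho, hko⟩ := Submodule.mem_sup.1 (Kk_split A r h1)
    have h2 : ((r : ℂ) + 1) • t - k = o - z := by
      rw [sub_eq_sub_iff_add_eq_add, ← hko]; abel
    have h3 : ((r : ℂ) + 1) • t - k = 0 := by
      refine (Submodule.disjoint_def.1 (eig_indep (n := n) (r + 1))) _ ?_ ?_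
      · exact sub_mem (Submodule.smul_mem _ _ ht) hk1.1
      · rw [h2]; exact sub_mem ho (Fle_other r hz)
    obtain ⟨-, y', hy', hq⟩ := hk1
    have hr : ((r : ℂ) + 1) ≠ 0 := by exact_mod_cast Nat.succ_ne_zero r
    have h4 : t = ((r : ℂ) + 1)⁻¹ • k := by
      rw [← sub_eq_zero.1 h3, smul_smul, inv_mul_cancel₀ hr, one_smul]
    have h5 : q A x = q A (((r : ℂ) + 1)⁻¹ • y' + y) := by
      rw [hxy, h4, map_add, map_add, map_smul, map_smul, hq]
    rw [h5]
    refine ih _ (add_mem (Submodule.smul_mem _ _ hy') hy) ?_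
    rw [← psi_q A h5, hk0]

lemma psi_inj (ψ : Onsager.OnsagerAlg A.a →ₗ⁅ℂ⁆ KacMoody.KM A)
    (hψ : ∀ i, ψ (Onsager.B A.a i) = KacMoody.Y A i) : Function.Injective ψ := by
  rw [injective_iff_map_eq_zero]
  intro x hx
  obtain ⟨y, rfl⟩ := mkHom_surj _ x
  obtain ⟨r, hr⟩ := Fle_exhaust y
  refine descent A r y hr ?_
  have : psiF A = ψ.comp (q A) := by
    apply FreeLieAlgebra.hom_ext
    intro i
    have h1 : psiF A (FreeLieAlgebra.of ℂ i) = KacMoody.Y A i := psiF_b A i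
    rw [h1, ← hψ]
    rfl
  rw [this]
  exact hx

end FreeSide

/-! ### The image is the fixed-point subalgebra -/

section Range

variable {n : ℕ} (A : GCM n)

open KacMoody (e f h KM Y)

/-- Left-normed brackets of the `e i`. -/
noncomputable def ew : List (Fin n) → KM A
  | [] => 0
  | [i] => e A i
  | i :: k :: w => ⁅e A i, ew (k :: w)⁆

lemma ew_nil : ew A [] = 0 := rfl
lemma ew_single (i : Fin n) : ew A [i] = e A i := rfl
lemma ew_cons (i k : Fin n) (w : List (Fin n)) :
    ew A (i :: k :: w) = ⁅e A i, ew A (k :: w)⁆ := rfl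

/-- Span of the `h k` and the brackets of length at most `r`. -/
noncomputable def G (r : ℕ) : Submodule ℂ (KM A) :=
  Submodule.span ℂ (Set.range (h A) ∪ {x | ∃ w : List (Fin n), w.length ≤ r ∧ x = ew A w})

lemma G_h (r : ℕ) (k : Fin n) : h A k ∈ G A r := Submodule.subset_span (Or.inl ⟨k, rfl⟩)

lemma G_ew {r : ℕ} {w : List (Fin n)} (hw : w.length ≤ r) : ew A w ∈ G A r :=
  Submodule.subset_span (Or.inr ⟨w, hw, rfl⟩)

lemma G_mono {r s : ℕ} (hrs : r ≤ s) : G A r ≤ G A s := by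
  apply Submodule.span_le.2
  rintro x (⟨k, rfl⟩ | ⟨w, hw, rfl⟩)
  · exact G_h A s k
  · exact G_ew A (hw.trans hrs)

lemma G_e (i : Fin n) {r : ℕ} {x : KM A} (hx : x ∈ G A r) : ⁅e A i, x⁆ ∈ G A (r + 1) := by
  induction hx using Submodule.span_induction with
  | mem x hx =>
    rcases hx with ⟨k, rfl⟩ | ⟨w, hw, rfl⟩
    · rw [← lie_skew, (km_CR A).he, ← ew_single]
      exact neg_mem (Submodule.smul_mem _ _ (G_ew A (by simp)))
    · cases w with
      | nil => rw [ew_nil, lie_zero]; exact zero_mem _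
      | cons k w =>
        rw [← ew_cons]
        exact G_ew A (by simpa using hw)
  | zero => rw [lie_zero]; exact zero_mem _
  | add x y _ _ hx hy => rw [lie_add]; exact add_mem hx hy
  | smul c x _ hx => rw [lie_smul]; exact Submodule.smul_mem _ _ hx

lemma h_ew (k : Fin n) (w : List (Fin n)) : ∃ c : ℂ, ⁅h A k, ew A w⁆ = c • ew A w := by
  induction w with
  | nil => exact ⟨0, by rw [ew_nil, lie_zero, smul_zero]⟩
  | cons i w ih =>
    cases w with
    | nil => exact ⟨_, by rw [ew_single]; exact (km_CR A).he k i⟩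
    | cons l w =>
      obtain ⟨c, hc⟩ := ih
      refine ⟨(A.a k i : ℂ) + c, ?_⟩
      rw [ew_cons, leibniz_lie, hc, (km_CR A).he, smul_lie, lie_smul, add_smul]

lemma fe (k i : Fin n) : ⁅f A k, e A i⁆ = if k = i then - h A k else 0 := by
  rw [← lie_skew, (km_CR A).ef]
  by_cases hki : k = i
  · subst hki; simp
  · simp [hki, Ne.symm hki]

lemma f_ew (k : Fin n) (w : List (Fin n)) : ⁅f A k, ew A w⁆ ∈ G A (w.length - 1) := by
  induction w with
  | nil => rw [ew_nil, lie_zero]; exact zero_mem _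
  | cons i w ih =>
    cases w with
    | nil =>
      rw [ew_single, fe]
      split_ifs
      · exact neg_mem (G_h A _ k)
      · exact zero_mem _
    | cons l w =>
      rw [ew_cons, leibniz_lie, fe]
      refine add_mem ?_ ?_
      · split_ifs
        · obtain ⟨c, hc⟩ := h_ew A k (l :: w)
          rw [neg_lie, hc]
          exact neg_mem (Submodule.smul_mem _ _ (G_ew A (by simp)))
        · rw [zero_lie]; exact zero_mem _
      · exact G_mono A (by simp) (G_e A i ih)

/-- The union of the `G r`. -/
noncomputable def Gall : Submodule ℂ (KM A) where
  carrier := {x | ∃ r, x ∈ G A r}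
  add_mem' := by
    rintro a b ⟨r, hr⟩ ⟨s, hs⟩
    exact ⟨r + s, add_mem (G_mono A (by omega) hr) (G_mono A (by omega) hs)⟩
  zero_mem' := ⟨0, zero_mem _⟩
  smul_mem' := by
    rintro c a ⟨r, hr⟩
    exact ⟨r, Submodule.smul_mem _ _ hr⟩

lemma km_gen (S : Submodule ℂ (KM A)) (he : ∀ i, e A i ∈ S) (hf : ∀ i, f A i ∈ S)
    (hh : ∀ i, h A i ∈ S) (he' : ∀ i, ∀ x ∈ S, ⁅e A i, x⁆ ∈ S)
    (hf' : ∀ i, ∀ x ∈ S, ⁅f A i, x⁆ ∈ S) (hh' : ∀ i, ∀ x ∈ S, ⁅h A i, x⁆ ∈ S) (x : KM A) :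
    x ∈ S := by
  obtain ⟨y, rfl⟩ := mkHom_surj _ x
  refine free_gen (S.comap (mkHom (KacMoody.relIdeal A) : KacMoody.FL n →ₗ[ℂ] KM A)) ?_ ?_ y
  · rintro (i | i | i)
    · exact he i
    · exact hf i
    · exact hh i
  · rintro (i | i | i) x hx
    · exact he' i _ hx
    · exact hf' i _ hx
    · exact hh' i _ hx

lemma km_ext {L : Type*} [LieRing L] [LieAlgebra ℂ L] {g g' : KM A →ₗ⁅ℂ⁆ L}
    (he : ∀ i, g (e A i) = g' (e A i)) (hf : ∀ i, g (f A i) = g' (f A i))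
    (hh : ∀ i, g (h A i) = g' (h A i)) (x : KM A) : g x = g' x := by
  obtain ⟨y, rfl⟩ := mkHom_surj _ x
  have : g.comp (mkHom (KacMoody.relIdeal A)) = g'.comp (mkHom (KacMoody.relIdeal A)) := by
    apply FreeLieAlgebra.hom_ext
    rintro (i | i | i)
    · exact he i
    · exact hf i
    · exact hh i
  exact congrArg (fun k : KacMoody.FL n →ₗ⁅ℂ⁆ L => k y) this

/-- The elements `x` with `x + ω x` in the image of `ψ`. -/
def S (ω : KM A →ₗ⁅ℂ⁆ KM A)
    (ψ : Onsager.OnsagerAlg A.a →ₗ⁅ℂ⁆ KM A) : Submodule ℂ (KM A) where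
  carrier := {x | x + ω x ∈ ψ.range}
  add_mem' := by
    intro a b ha hb
    have : a + b + ω (a + b) = (a + ω a) + (b + ω b) := by rw [map_add]; abel
    rw [Set.mem_ofPred_eq, this]
    exact add_mem ha hb
  zero_mem' := by
    rw [Set.mem_ofPred_eq, map_zero, add_zero]; exact zero_mem _
  smul_mem' := by
    intro c a ha
    rw [Set.mem_ofPred_eq, map_smul, ← smul_add]
    exact ψ.range.smul_mem c ha

lemma ww (ω : KM A →ₗ⁅ℂ⁆ KM A)
    (we : ∀ i, ω (e A i) = - f A i) (wf : ∀ i, ω (f A i) = - e A i)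
    (wh : ∀ i, ω (h A i) = - h A i) (x : KM A) : ω (ω x) = x := by
  refine km_ext A (g := ω.comp ω) (g' := LieHom.id) ?_ ?_ ?_ x
  · intro i
    rw [LieHom.comp_apply, we, map_neg, wf, neg_neg]; rfl
  · intro i
    rw [LieHom.comp_apply, wf, map_neg, we, neg_neg]; rfl
  · intro i
    rw [LieHom.comp_apply, wh, map_neg, wh, neg_neg]; rfl

lemma G_le_S (ω : KM A →ₗ⁅ℂ⁆ KM A)
    (we : ∀ i, ω (e A i) = - f A i) (wf : ∀ i, ω (f A i) = - e A i)
    (wh : ∀ i, ω (h A i) = - h A i)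
    (ψ : Onsager.OnsagerAlg A.a →ₗ⁅ℂ⁆ KM A) (hψ : ∀ i, ψ (Onsager.B A.a i) = Y A i) (r : ℕ) : G A r ≤ S A ω ψ := by
  have hh : ∀ k, h A k ∈ S A ω ψ := by
    intro k
    change h A k + ω (h A k) ∈ ψ.range
    rw [wh, add_neg_cancel]; exact zero_mem _
  induction r with
  | zero =>
    apply Submodule.span_le.2
    rintro x (⟨k, rfl⟩ | ⟨w, hw, rfl⟩)
    · exact hh k
    · have : w = [] := List.length_eq_zero_iff.1 (by omega)
      subst this
      exact zero_mem _
  | succ r ih =>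
    apply Submodule.span_le.2
    rintro x (⟨k, rfl⟩ | ⟨w, hw, rfl⟩)
    · exact hh k
    · rcases w with _ | ⟨i, _ | ⟨k, w⟩⟩
      · exact zero_mem _
      · change e A i + ω (e A i) ∈ ψ.range
        rw [we, ← sub_eq_add_neg]
        exact ⟨_, hψ i⟩
      · have hz : ew A (k :: w) ∈ S A ω ψ := ih (G_ew A (by simpa using hw))
        have hy : ⁅f A i, ew A (k :: w)⁆ ∈ S A ω ψ :=
          ih (G_mono A (by simp at hw ⊢; omega) (f_ew A i (k :: w)))
        rw [ew_cons]
        generalize ew A (k :: w) = z at hz hy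
        change ⁅e A i, z⁆ + ω ⁅e A i, z⁆ ∈ ψ.range
        change z + ω z ∈ ψ.range at hz
        change ⁅f A i, z⁆ + ω ⁅f A i, z⁆ ∈ ψ.range at hy
        have hY : e A i - f A i ∈ ψ.range := ⟨_, hψ i⟩
        have := add_mem (ψ.range.lie_mem hY hz) hy
        convert this using 1
        rw [LieHom.map_lie, LieHom.map_lie, we, wf]
        simp only [sub_lie, lie_add, neg_lie]
        abel

lemma span_top (ω : KM A →ₗ⁅ℂ⁆ KM A)
    (we : ∀ i, ω (e A i) = - f A i) (wf : ∀ i, ω (f A i) = - e A i)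
    (wh : ∀ i, ω (h A i) = - h A i) (x : KM A) :
    x ∈ Gall A ⊔ (Gall A).map (ω : KM A →ₗ[ℂ] KM A) := by
  set V := Gall A ⊔ (Gall A).map (ω : KM A →ₗ[ℂ] KM A) with hV
  have hω : ∀ x ∈ V, ω x ∈ V := by
    intro x hx
    obtain ⟨a, ha, b, ⟨c, hc, rfl⟩, rfl⟩ := Submodule.mem_sup.1 hx
    rw [map_add]
    refine add_mem ?_ ?_
    · exact Submodule.mem_sup_right ⟨a, ha, rfl⟩
    · refine Submodule.mem_sup_left ?_
      have : ω (ω c) = c := ww A ω we wf wh c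
      change ω (ω c) ∈ Gall A
      rwa [this]
  have hG : ∀ x ∈ Gall A, x ∈ V := fun x hx => Submodule.mem_sup_left hx
  have he0 : ∀ i, e A i ∈ V := fun i => hG _ ⟨1, G_ew A (w := [i]) (by simp)⟩
  have hf0 : ∀ i, f A i ∈ V := by
    intro i
    have := neg_mem (hω _ (he0 i))
    rwa [we, neg_neg] at this
  have hh0 : ∀ i, h A i ∈ V := fun i => hG _ ⟨0, G_h A 0 i⟩
  have eG : ∀ i, ∀ x ∈ Gall A, ⁅e A i, x⁆ ∈ V := by
    rintro i x ⟨r, hr⟩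
    exact hG _ ⟨r + 1, G_e A i hr⟩
  have fG : ∀ i, ∀ x ∈ Gall A, ⁅f A i, x⁆ ∈ V := by
    rintro i x ⟨r, hr⟩
    induction hr using Submodule.span_induction with
    | mem x hx =>
      rcases hx with ⟨k, rfl⟩ | ⟨w, hw, rfl⟩
      · rw [← lie_skew, (km_CR A).hf, neg_neg]
        exact Submodule.smul_mem _ _ (hf0 i)
      · exact hG _ ⟨_, f_ew A i w⟩
    | zero => rw [lie_zero]; exact zero_mem _
    | add x y _ _ hx hy => rw [lie_add]; exact add_mem hx hy
    | smul c x _ hx => rw [lie_smul]; exact Submodule.smul_mem _ _ hx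
  have hhG : ∀ i, ∀ x ∈ Gall A, ⁅h A i, x⁆ ∈ V := by
    rintro i x ⟨r, hr⟩
    induction hr using Submodule.span_induction with
    | mem x hx =>
      rcases hx with ⟨k, rfl⟩ | ⟨w, hw, rfl⟩
      · rw [km_hh]; exact zero_mem _
      · obtain ⟨c, hc⟩ := h_ew A i w
        rw [hc]
        exact Submodule.smul_mem _ _ (hG _ ⟨_, G_ew A hw⟩)
    | zero => rw [lie_zero]; exact zero_mem _
    | add x y _ _ hx hy => rw [lie_add]; exact add_mem hx hy
    | smul c x _ hx => rw [lie_smul]; exact Submodule.smul_mem _ _ hx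
  refine km_gen A V he0 hf0 hh0 ?_ ?_ ?_ x
  · intro i x hx
    obtain ⟨a, ha, b, ⟨c, hc, rfl⟩, rfl⟩ := Submodule.mem_sup.1 hx
    rw [lie_add]
    refine add_mem (eG i a ha) ?_
    have := neg_mem (hω _ (fG i c hc))
    rw [LieHom.map_lie, wf, neg_lie, neg_neg] at this
    exact this
  · intro i x hx
    obtain ⟨a, ha, b, ⟨c, hc, rfl⟩, rfl⟩ := Submodule.mem_sup.1 hx
    rw [lie_add]
    refine add_mem (fG i a ha) ?_
    have := neg_mem (hω _ (eG i c hc))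
    rw [LieHom.map_lie, we, neg_lie, neg_neg] at this
    exact this
  · intro i x hx
    obtain ⟨a, ha, b, ⟨c, hc, rfl⟩, rfl⟩ := Submodule.mem_sup.1 hx
    rw [lie_add]
    refine add_mem (hhG i a ha) ?_
    have := neg_mem (hω _ (hhG i c hc))
    rw [LieHom.map_lie, wh, neg_lie, neg_neg] at this
    exact this

lemma range_eq (ω : KM A →ₗ⁅ℂ⁆ KM A)
    (we : ∀ i, ω (e A i) = - f A i) (wf : ∀ i, ω (f A i) = - e A i)
    (wh : ∀ i, ω (h A i) = - h A i)
    (ψ : Onsager.OnsagerAlg A.a →ₗ⁅ℂ⁆ KM A) (hψ : ∀ i, ψ (Onsager.B A.a i) = Y A i) : Set.range ψ = {x : KM A | ω x = x} := by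
  apply Set.Subset.antisymm
  · rintro _ ⟨x, rfl⟩
    obtain ⟨y, rfl⟩ := mkHom_surj _ x
    have : (ω.comp ψ).comp (mkHom (Onsager.relIdeal A.a)) =
        ψ.comp (mkHom (Onsager.relIdeal A.a)) := by
      apply FreeLieAlgebra.hom_ext
      intro i
      change ω (ψ (Onsager.B A.a i)) = ψ (Onsager.B A.a i)
      rw [hψ, Y, map_sub, we, wf]
      abel
    exact congrArg (fun k : Onsager.OFL n →ₗ⁅ℂ⁆ KM A => k y) this
  · intro x hx
    have hS : x ∈ S A ω ψ := by
      obtain ⟨a, ⟨r, ha⟩, b, ⟨c, ⟨s, hc⟩, rfl⟩, rfl⟩ :=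
        Submodule.mem_sup.1 (span_top A ω we wf wh x)
      refine add_mem (G_le_S A ω we wf wh ψ hψ r ha) ?_
      have h1 : c + ω c ∈ ψ.range := G_le_S A ω we wf wh ψ hψ s hc
      change ω c + ω (ω c) ∈ ψ.range
      rw [ww A ω we wf wh, add_comm]
      exact h1
    have h1 : x + ω x ∈ ψ.range := hS
    rw [show ω x = x from hx] at h1
    have h2 : x = (2⁻¹ : ℂ) • (x + x) := by
      rw [← two_smul ℂ x, smul_smul]; simp
    rw [h2]
    exact ψ.range.smul_mem _ h1

end Range

end OnsagerProof

open KacMoody Onsager in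
/-- The Lie algebra homomorphism `ψ : L(A) → g(A)` determined by `ψ (B i) = Y i = e i - f i`
exists, is injective, and its image is the fixed-point Lie subalgebra
`k(A) = {x : ω x = x}` of the Chevalley involution `ω`; i.e. `ψ : L(A) ≅ k(A)`. -/
theorem onsager_iso_fixed_points {n : ℕ} (A : GCM n) :
    (∃ ψ : OnsagerAlg A.a →ₗ⁅ℂ⁆ KM A, ∀ i, ψ (B A.a i) = Y A i) ∧
    (∀ ψ : OnsagerAlg A.a →ₗ⁅ℂ⁆ KM A, (∀ i, ψ (B A.a i) = Y A i) →
      (Function.Injective ψ ∧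
        ∀ ω : KM A →ₗ⁅ℂ⁆ KM A,
          (∀ i, ω (e A i) = - f A i) → (∀ i, ω (f A i) = - e A i) →
          (∀ i, ω (h A i) = - h A i) →
          Set.range ψ = {x : KM A | ω x = x})) := by
  refine ⟨OnsagerProof.psi_exists A, fun ψ hψ => ⟨OnsagerProof.psi_inj A ψ hψ, ?_⟩⟩
  intro ω we wf wh
  exact OnsagerProof.range_eq A ω we wf wh ψ hψ
end

section
/- Let A be a symmetrizable generalized Cartan matrix and L(A) the generalized Onsager algebra, filtered by the subspaces L_j(A) spanned by all iterated brackets of the generators of length at most j. Let Gr(L(A)) := ⊕_{j≥1} L_j(A)/L_{j−1}(A) be the associated graded Lie algebra and [x]_j := x + L_{j−1}(A). Let n(A) be the complex Lie algebra with generators e_1, …, e_n and defining relations (ad e_i)^{1−a_{ij}} e_j = 0 for i ≠ j. Then the Lie algebra homomorphism φ: n(A) → Gr(L(A)) determined by φ(e_i) = [B_i]_1 (1 ≤ i ≤ n) is an isomorphism of graded Lie algebras. -/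
namespace Onsager

variable {n : ℕ}

/-- Right-normed iterated brackets `[B i, [B i₁, [… , B iₘ]…]]` of the generators of `L(A)`. -/
noncomputable def word (a : Fin n → Fin n → ℤ) : Fin n → List (Fin n) → OnsagerAlg a
  | i, [] => B a i
  | i, j :: l => ⁅B a i, word a j l⁆

/-- The filtration `L_j(A)`: the span of all iterated brackets of the generators
of length at most `j` (so `L_0(A) = 0`). -/
noncomputable def Lfil (a : Fin n → Fin n → ℤ) (j : ℕ) : Submodule ℂ (OnsagerAlg a) :=
  Submodule.span ℂ {x | ∃ (i : Fin n) (l : List (Fin n)), l.length + 1 ≤ j ∧ x = word a i l}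

/-- The `j`-th graded component `Gr_j(L(A)) = L_j(A) / L_{j-1}(A)`. -/
abbrev GrMod (a : Fin n → Fin n → ℤ) (j : ℕ) : Type :=
  Lfil a j ⧸ (Lfil a (j - 1)).comap (Lfil a j).subtype

/-- The associated graded vector space `Gr(L(A)) = ⊕_j Gr_j(L(A))`. -/
abbrev Gr (a : Fin n → Fin n → ℤ) : Type := DirectSum ℕ (fun j => GrMod a j)

/-- The class `[x]_j ∈ Gr_j(L(A)) ⊆ Gr(L(A))` of an element `x ∈ L_j(A)`. -/
noncomputable def mkGr (a : Fin n → Fin n → ℤ) (j : ℕ) (x : OnsagerAlg a)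
    (hx : x ∈ Lfil a j) : Gr a :=
  DirectSum.of (fun j => GrMod a j) j (Submodule.Quotient.mk ⟨x, hx⟩)

theorem B_mem_Lfil_one (a : Fin n → Fin n → ℤ) (i : Fin n) : B a i ∈ Lfil a 1 :=
  Submodule.subset_span ⟨i, [], by simp, rfl⟩

/-- The nilpotent Lie algebra `n(A)`, presented by generators `e i` and the Serre
relations `(ad (e i))^{1-a_{ij}} (e j) = 0` for `i ≠ j`. -/
noncomputable def serreRelations (a : Fin n → Fin n → ℤ) : Set (OFL n) :=
  {x | ∃ i j : Fin n, i ≠ j ∧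
    x = ((LieAlgebra.ad ℂ (OFL n) (Bf i)) ^ (1 - a i j).toNat) (Bf j)}

noncomputable def serreIdeal (a : Fin n → Fin n → ℤ) : LieIdeal ℂ (OFL n) :=
  LieSubmodule.lieSpan ℂ (OFL n) (serreRelations a)

abbrev NilpAlg (a : Fin n → Fin n → ℤ) : Type := OFL n ⧸ serreIdeal a

noncomputable def eN (a : Fin n → Fin n → ℤ) (i : Fin n) : NilpAlg a :=
  LieSubmodule.Quotient.mk (N := serreIdeal a) (Bf i)

end Onsager


namespace Onsager

section abstractLie
variable {L : Type*} [LieRing L] [LieAlgebra ℂ L]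

/-- iterated adjoint action -/
noncomputable def adp (X Z : L) (m : ℕ) : L := ((LieAlgebra.ad ℂ L X) ^ m) Z

lemma adp_zero (X Z : L) : adp X Z 0 = Z := by simp [adp]

lemma adp_succ (X Z : L) (m : ℕ) : adp X Z (m + 1) = ⁅X, adp X Z m⁆ := by
  simp [adp, pow_succ']

lemma map_adp {L' : Type*} [LieRing L'] [LieAlgebra ℂ L'] (f : L →ₗ⁅ℂ⁆ L') (X Z : L) (m : ℕ) :
    f (adp X Z m) = adp (f X) (f Z) m := by
  induction m with
  | zero => simp [adp_zero]
  | succ m ih => rw [adp_succ, adp_succ, LieHom.map_lie, ih]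

lemma lie_K_adp (K X Z : L) (p q : ℂ) (h1 : ⁅K, X⁆ = p • X) (h2 : ⁅K, Z⁆ = q • Z) (m : ℕ) :
    ⁅K, adp X Z m⁆ = (m * p + q) • adp X Z m := by
  induction m with
  | zero => simp [adp_zero, h2]
  | succ m ih =>
    rw [adp_succ, leibniz_lie, h1, ih, smul_lie, lie_smul, ← add_smul]
    congr 1
    push_cast
    ring

lemma lie_Y_adp (X Z Y K : L) (a : ℂ) (h1 : ⁅Y, X⁆ = K) (h2 : ⁅K, X⁆ = (2 : ℂ) • X)
    (h3 : ⁅K, Z⁆ = a • Z) (h4 : ⁅Y, Z⁆ = 0) (m : ℕ) :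
    ⁅Y, adp X Z (m + 1)⁆ = (((m : ℂ) + 1) * (m + a)) • adp X Z m := by
  induction m with
  | zero => simp [adp_succ, adp_zero, leibniz_lie Y X Z, h1, h3, h4]
  | succ m ih =>
    rw [adp_succ, leibniz_lie, h1, ih, lie_K_adp K X Z 2 a h2 h3, lie_smul, ← adp_succ, ← add_smul]
    congr 1
    push_cast
    ring

lemma lie_comm_adp (X Z Y : L) (h1 : ⁅Y, X⁆ = 0) (m : ℕ) :
    ⁅Y, adp X Z m⁆ = adp X ⁅Y, Z⁆ m := by
  induction m with
  | zero => simp [adp_zero]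
  | succ m ih => rw [adp_succ, adp_succ, leibniz_lie, h1, ih]; simp

lemma adp_zero_right (X : L) (m : ℕ) : adp X (0 : L) m = 0 := by simp [adp]

lemma serre_commute {n : ℕ} (A : GCM n) (X Y K : Fin n → L)
    (h1 : ∀ i, ⁅Y i, X i⁆ = K i) (h1' : ∀ i j, i ≠ j → ⁅Y i, X j⁆ = 0)
    (h2 : ∀ i j, ⁅K i, X j⁆ = (A.a i j : ℂ) • X j) (k i j : Fin n) (hij : i ≠ j) :
    ⁅Y k, adp (X i) (X j) (1 - A.a i j).toNat⁆ = 0 := by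
  obtain ⟨m, hm⟩ := Int.eq_ofNat_of_zero_le (neg_nonneg.mpr (A.off_nonpos i j hij))
  have ha : A.a i j = -(m : ℤ) := by omega
  have hN : (1 - A.a i j).toNat = m + 1 := by omega
  rw [hN]
  by_cases hki : k = i
  · subst hki
    rw [lie_Y_adp (X k) (X j) (Y k) (K k) (A.a k j) (h1 k) (by rw [h2, A.diag]; norm_num) (h2 k j)
      (h1' k j hij), ha]
    simp
  · rw [lie_comm_adp _ _ _ (h1' k i hki)]
    by_cases hkj : k = j
    · subst hkj
      rw [h1]
      have e : ⁅X i, K k⁆ = -((A.a k i : ℂ) • X i) := by rw [← lie_skew, h2]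
      cases m with
      | zero =>
        have : A.a k i = 0 := by rw [A.zero_iff]; simpa using ha
        rw [adp_succ, adp_zero, e, this]; simp
      | succ m =>
        have : ∀ r, adp (X i) (K k) (r + 2) = 0 := by
          intro r
          induction r with
          | zero => simp [adp_succ, adp_zero, e]
          | succ r ih => rw [adp_succ, ih, lie_zero]
        exact this m
    · rw [h1' k j hkj, adp_zero_right]

/-- The main identity : inhomogeneous Serre polynomial of `F + E`. -/
lemma onsager_identity (a : ℤ) (F E F' E' K : L)
    (hEF : ⁅E, F⁆ = K) (hEF' : ⁅E, F'⁆ = 0) (hFE' : ⁅F, E'⁆ = 0)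
    (hKF : ⁅K, F⁆ = (2 : ℂ) • F) (hKF' : ⁅K, F'⁆ = (a : ℂ) • F')
    (hKE : ⁅K, E⁆ = -((2 : ℂ) • E)) (hKE' : ⁅K, E'⁆ = -((a : ℂ) • E')) (r : ℕ) :
    ∀ M, r < M → ∑ s ∈ Finset.range M, (onsagerC a r s : ℂ) • adp (F + E) (F' + E') s =
      adp F F' r + adp E E' r := by
  have hX := lie_Y_adp F F' E K a hEF hKF hKF' hEF'
  have hY := lie_Y_adp E E' F (-K) a (by rw [← lie_skew, hEF]) (by rw [neg_lie, hKE, neg_neg])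
    (by rw [neg_lie, hKE', neg_neg]) hFE'
  induction r using Nat.strong_induction_on with
  | _ r ih =>
  intro M hM
  match r, ih, hM with
  | 0, _, hM =>
    rw [Finset.sum_eq_single 0] <;> simp +contextual [onsagerC, adp_zero]
    omega
  | 1, _, hM =>
    rw [Finset.sum_eq_single 1]
    · simp [onsagerC, adp_zero, adp_succ, hEF', hFE']
    · intro b _ hb; simp [onsagerC, hb]
    · simp; omega
  | (r + 2), ih, hM =>
    obtain ⟨M, rfl⟩ : ∃ M', M = M' + 1 := ⟨M - 1, by omega⟩
    have e1 := ih (r + 1) (by omega) M (by omega)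
    have e2 := ih r (by omega) (M + 1) (by omega)
    have : ∀ s, (onsagerC a (r + 2) s : ℂ) • adp (F + E) (F' + E') s =
      (if s = 0 then 0 else (onsagerC a (r + 1) (s - 1) : ℂ) • adp (F + E) (F' + E') s) -
      (((r : ℂ) + 1) * (r + a)) • ((onsagerC a r s : ℂ) • adp (F + E) (F' + E') s) := by
      intro s
      rw [onsagerC]
      split_ifs <;> simp [sub_smul, smul_smul, mul_assoc]
    simp_rw [this]
    rw [Finset.sum_sub_distrib, ← Finset.smul_sum, e2, Finset.sum_range_succ']
    have e3 : ∑ k ∈ Finset.range M, (if k + 1 = 0 then 0 else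
        (onsagerC a (r + 1) (k + 1 - 1) : ℂ) • adp (F + E) (F' + E') (k + 1)) =
        ⁅F + E, adp F F' (r + 1) + adp E E' (r + 1)⁆ := by
      rw [← e1, lie_sum]
      refine Finset.sum_congr rfl fun k _ => ?_
      simp [adp_succ]
    rw [e3]
    simp only [add_lie, lie_add, hX, hY, ← adp_succ, if_true]
    rw [smul_add]
    abel

end abstractLie

end Onsager
set_option linter.unusedSimpArgs false

namespace Onsager

section operators

attribute [local instance] LieRing.ofAssociativeRing

variable {n : ℕ}

/-- The vector space with basis the words in `Fin n`. -/
abbrev TT (n : ℕ) : Type := List (Fin n) →₀ ℂ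

/-- The basis vector of a word. -/
noncomputable def bv (l : List (Fin n)) : TT n := Finsupp.single l 1

/-- The linear map with prescribed values on words. -/
noncomputable def mkOp {V : Type*} [AddCommGroup V] [Module ℂ V] (g : List (Fin n) → V) :
    TT n →ₗ[ℂ] V := Finsupp.linearCombination ℂ g

lemma mkOp_bv {V : Type*} [AddCommGroup V] [Module ℂ V] (g : List (Fin n) → V)
    (l : List (Fin n)) : mkOp g (bv l) = g l := by simp [mkOp, bv]

lemma op_ext {V : Type*} [AddCommGroup V] [Module ℂ V] {f g : TT n →ₗ[ℂ] V}
    (h : ∀ l, f (bv l) = g (bv l)) : f = g := by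
  apply Finsupp.lhom_ext'
  intro l
  ext
  exact h l

/-- Left multiplication by a letter. -/
noncomputable def Fo (i : Fin n) : Module.End ℂ (TT n) := mkOp fun l => bv (i :: l)

/-- The weight of a word. -/
noncomputable def wt (a : Fin n → Fin n → ℤ) (i : Fin n) (l : List (Fin n)) : ℂ :=
  (l.map fun j => (a i j : ℂ)).sum

/-- The weight operator. -/
noncomputable def Ko (a : Fin n → Fin n → ℤ) (i : Fin n) : Module.End ℂ (TT n) :=
  mkOp fun l => wt a i l • bv l

/-- The value of the lowering operator on a word. -/
noncomputable def eoVal (a : Fin n → Fin n → ℤ) (i : Fin n) : List (Fin n) → TT n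
  | [] => 0
  | j :: l => Fo j (eoVal a i l) + if i = j then Ko a i (bv l) else 0

/-- The lowering operator. -/
noncomputable def Eo (a : Fin n → Fin n → ℤ) (i : Fin n) : Module.End ℂ (TT n) :=
  mkOp (eoVal a i)

lemma Fo_bv (i : Fin n) (l : List (Fin n)) : Fo i (bv l) = bv (i :: l) := mkOp_bv _ _

lemma Ko_bv (a : Fin n → Fin n → ℤ) (i : Fin n) (l : List (Fin n)) :
    Ko a i (bv l) = wt a i l • bv l := mkOp_bv _ _

lemma Eo_nil (a : Fin n → Fin n → ℤ) (i : Fin n) : Eo a i (bv []) = 0 := mkOp_bv _ _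

lemma Eo_bv_cons (a : Fin n → Fin n → ℤ) (i j : Fin n) (l : List (Fin n)) :
    Eo a i (bv (j :: l)) = Fo j (Eo a i (bv l)) + if i = j then Ko a i (bv l) else 0 := by
  simp only [Eo, mkOp_bv, eoVal]

lemma lie_Eo_Fo_same (a : Fin n → Fin n → ℤ) (i : Fin n) : ⁅Eo a i, Fo i⁆ = Ko a i := by
  apply op_ext
  intro l
  simp [Ring.lie_def, Fo_bv, Eo_bv_cons]

lemma lie_Eo_Fo_ne (a : Fin n → Fin n → ℤ) (i j : Fin n) (h : i ≠ j) : ⁅Eo a i, Fo j⁆ = 0 := by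
  apply op_ext
  intro l
  simp [Ring.lie_def, Fo_bv, Eo_bv_cons, h]

lemma lie_Ko_Fo (a : Fin n → Fin n → ℤ) (i j : Fin n) :
    ⁅Ko a i, Fo j⁆ = (a i j : ℂ) • Fo j := by
  apply op_ext
  intro l
  simp [Ring.lie_def, Fo_bv, Ko_bv, wt, add_smul]

lemma lie_Ko_Ko (a : Fin n → Fin n → ℤ) (i j : Fin n) : ⁅Ko a i, Ko a j⁆ = 0 := by
  apply op_ext
  intro l
  simp [Ring.lie_def, Ko_bv, smul_smul, mul_comm]

lemma Ko_nil (a : Fin n → Fin n → ℤ) (i : Fin n) : Ko a i (bv []) = 0 := by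
  simp [Ko_bv, wt]

lemma of_lie_eq {X Y Z : Module.End ℂ (TT n)} (h : ⁅X, Y⁆ = Z) (u : TT n) :
    X (Y u) = Y (X u) + Z u := by
  rw [← h]; simp [Ring.lie_def]

/-- An operator killing the empty word and commuting with left multiplications is zero. -/
lemma eq_zero_of_commute (C : Module.End ℂ (TT n)) (h0 : C (bv []) = 0)
    (h : ∀ k : Fin n, ⁅Fo k, C⁆ = 0) : C = 0 := by
  apply op_ext
  intro l
  induction l with
  | nil => simpa using h0
  | cons k l ih =>
    have := of_lie_eq (h k) (bv l)
    rw [ih, Fo_bv] at this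
    simpa using this.symm

lemma Ko_Eo_apply (a : Fin n → Fin n → ℤ) (i j : Fin n) (l : List (Fin n)) :
    Ko a i (Eo a j (bv l)) = (wt a i l - a i j) • Eo a j (bv l) := by
  induction l with
  | nil => simp [Eo_nil]
  | cons k l ih =>
    rw [Eo_bv_cons, map_add, of_lie_eq (lie_Ko_Fo a i k), ih]
    have : wt a i (k :: l) = a i k + wt a i l := by simp [wt]
    rw [this]
    by_cases h : j = k
    · subst h
      simp only [if_true, Ko_bv, map_smul, LinearMap.smul_apply]
      module
    · simp only [if_neg h, map_zero, map_smul, LinearMap.smul_apply]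
      module

lemma lie_ap (X Y : Module.End ℂ (TT n)) (u : TT n) : ⁅X, Y⁆ u = X (Y u) - Y (X u) := rfl

lemma neg_ap (X : Module.End ℂ (TT n)) (u : TT n) : (-X) u = -(X u) := rfl

lemma smul_ap (c : ℂ) (X : Module.End ℂ (TT n)) (u : TT n) : (c • X) u = c • (X u) := rfl

lemma zero_ap (u : TT n) : (0 : Module.End ℂ (TT n)) u = 0 := rfl

lemma lie_Ko_Eo (a : Fin n → Fin n → ℤ) (i j : Fin n) :
    ⁅Ko a i, Eo a j⁆ = -((a i j : ℂ) • Eo a j) := by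
  apply op_ext
  intro l
  rw [lie_ap, neg_ap, smul_ap, Ko_bv, map_smul, Ko_Eo_apply, sub_smul, sub_sub_cancel_left]

lemma lie_neg_Ko_Eo (a : Fin n → Fin n → ℤ) (i j : Fin n) :
    ⁅-Ko a i, Eo a j⁆ = (a i j : ℂ) • Eo a j := by
  apply op_ext
  intro l
  rw [lie_ap, neg_ap, neg_ap, smul_ap, Ko_bv, map_neg, map_smul, Ko_Eo_apply, sub_smul, neg_sub,
    sub_neg_eq_add, sub_add_cancel]

lemma lie_Fo_Eo_same (a : Fin n → Fin n → ℤ) (i : Fin n) : ⁅Fo i, Eo a i⁆ = -Ko a i := by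
  apply op_ext
  intro l
  rw [lie_ap, neg_ap, ← lie_Eo_Fo_same, lie_ap, neg_sub]

lemma lie_Fo_Eo_ne (a : Fin n → Fin n → ℤ) (i j : Fin n) (h : i ≠ j) : ⁅Fo i, Eo a j⁆ = 0 := by
  apply op_ext
  intro l
  rw [lie_ap, of_lie_eq (lie_Eo_Fo_ne a j i h.symm), zero_ap, add_zero, sub_self]

lemma adp_apply_eq_zero (X Z : Module.End ℂ (TT n)) (v : TT n) (hX : X v = 0) (hZ : Z v = 0)
    (m : ℕ) : adp X Z m v = 0 := by
  induction m with
  | zero => simpa [adp_zero]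
  | succ m ih => simp [adp_succ, Ring.lie_def, ih, hX]

lemma Eo_serre (A : GCM n) (i j : Fin n) (hij : i ≠ j) :
    adp (Eo A.a i) (Eo A.a j) (1 - A.a i j).toNat = 0 := by
  apply eq_zero_of_commute
  · exact adp_apply_eq_zero _ _ _ (Eo_nil _ _) (Eo_nil _ _) _
  · intro k
    apply serre_commute A (Eo A.a) Fo (fun i => -Ko A.a i)
    · exact lie_Fo_Eo_same _
    · exact lie_Fo_Eo_ne _
    · intro i j; exact lie_neg_Ko_Eo _ _ _
    · exact hij

/-- The Serre operator. -/
noncomputable def So (a : Fin n → Fin n → ℤ) (i j : Fin n) : Module.End ℂ (TT n) :=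
  adp (Fo i) (Fo j) (1 - a i j).toNat

lemma lie_Eo_So (A : GCM n) (k i j : Fin n) (hij : i ≠ j) : ⁅Eo A.a k, So A.a i j⁆ = 0 :=
  serre_commute A Fo (Eo A.a) (Ko A.a) (lie_Eo_Fo_same _) (lie_Eo_Fo_ne _) (lie_Ko_Fo _) k i j hij

/-- The operators representing the generators of the Onsager algebra. -/
noncomputable def Bo (a : Fin n → Fin n → ℤ) (i : Fin n) : Module.End ℂ (TT n) := Fo i + Eo a i

lemma Bo_relation (A : GCM n) (i j : Fin n) (hij : i ≠ j) :
    ∑ s ∈ Finset.range ((1 - A.a i j).toNat + 1),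
      (onsagerC (A.a i j) (1 - A.a i j).toNat s : ℂ) • adp (Bo A.a i) (Bo A.a j) s =
    So A.a i j := by
  have h2 : ((A.a i i : ℤ) : ℂ) = 2 := by rw [A.diag]; norm_num
  have := onsager_identity (A.a i j) (Fo i) (Eo A.a i) (Fo j) (Eo A.a j) (Ko A.a i)
    (lie_Eo_Fo_same _ _) (lie_Eo_Fo_ne _ _ _ hij)
    (lie_Fo_Eo_ne _ _ _ hij)
    (by rw [lie_Ko_Fo, h2]) (lie_Ko_Fo _ _ _) (by rw [lie_Ko_Eo, h2]) (lie_Ko_Eo _ _ _)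
    (1 - A.a i j).toNat _ (Nat.lt_succ_self _)
  rw [Eo_serre A i j hij, add_zero] at this
  exact this

/-- The left ideal generated by the Serre elements (times anything on the right). -/
noncomputable def JJ (a : Fin n → Fin n → ℤ) : Submodule ℂ (TT n) :=
  Submodule.span ℂ {x | ∃ (w : List (Fin n)) (i j : Fin n) (u : TT n), i ≠ j ∧
    x = (w.map Fo).prod (So a i j u)}

lemma So_mem_JJ (a : Fin n → Fin n → ℤ) (i j : Fin n) (hij : i ≠ j) (u : TT n) :
    So a i j u ∈ JJ a := Submodule.subset_span ⟨[], i, j, u, hij, by simp⟩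

lemma Fo_JJ (a : Fin n → Fin n → ℤ) (k : Fin n) (x : TT n) (hx : x ∈ JJ a) :
    Fo k x ∈ JJ a := by
  induction hx using Submodule.span_induction with
  | mem x h =>
    obtain ⟨w, i, j, u, hij, rfl⟩ := h
    exact Submodule.subset_span ⟨k :: w, i, j, u, hij, by simp⟩
  | zero => simp
  | add x y _ _ hx hy => rw [map_add]; exact add_mem hx hy
  | smul c x _ hx => rw [map_smul]; exact Submodule.smul_mem _ _ hx

lemma Ko_JJ (a : Fin n → Fin n → ℤ) (k : Fin n) (x : TT n) (hx : x ∈ JJ a) :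
    Ko a k x ∈ JJ a := by
  induction hx using Submodule.span_induction with
  | mem x h =>
    obtain ⟨w, i, j, u, hij, rfl⟩ := h
    induction w with
    | nil =>
      simp only [List.map_nil, List.prod_nil, Module.End.one_apply]
      erw [of_lie_eq (lie_K_adp (Ko a k) (Fo i) (Fo j) _ _ (lie_Ko_Fo _ _ _) (lie_Ko_Fo _ _ _)
        (1 - a i j).toNat) u]
      exact add_mem (So_mem_JJ a i j hij _) (Submodule.smul_mem _ _ (So_mem_JJ a i j hij _))
    | cons f w ih =>
      simp only [List.map_cons, List.prod_cons, Module.End.mul_apply]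
      rw [of_lie_eq (lie_Ko_Fo a k f)]
      exact add_mem (Fo_JJ _ _ _ ih) (Submodule.smul_mem _ _ (Fo_JJ _ _ _
        (Submodule.subset_span ⟨w, i, j, u, hij, rfl⟩)))
  | zero => simp
  | add x y _ _ hx hy => rw [map_add]; exact add_mem hx hy
  | smul c x _ hx => rw [map_smul]; exact Submodule.smul_mem _ _ hx

lemma Eo_JJ (A : GCM n) (k : Fin n) (x : TT n) (hx : x ∈ JJ A.a) :
    Eo A.a k x ∈ JJ A.a := by
  induction hx using Submodule.span_induction with
  | mem x h =>
    obtain ⟨w, i, j, u, hij, rfl⟩ := h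
    induction w with
    | nil =>
      simp only [List.map_nil, List.prod_nil, Module.End.one_apply]
      rw [of_lie_eq (lie_Eo_So A k i j hij)]
      exact add_mem (So_mem_JJ _ i j hij _) (by simp)
    | cons f w ih =>
      simp only [List.map_cons, List.prod_cons, Module.End.mul_apply]
      by_cases h : k = f
      · subst h
        rw [of_lie_eq (lie_Eo_Fo_same A.a k)]
        exact add_mem (Fo_JJ _ _ _ ih) (Ko_JJ _ _ _
          (Submodule.subset_span ⟨w, i, j, u, hij, rfl⟩))
      · rw [of_lie_eq (lie_Eo_Fo_ne A.a k f h)]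
        exact add_mem (Fo_JJ _ _ _ ih) (by simp)
  | zero => simp
  | add x y _ _ hx hy => rw [map_add]; exact add_mem hx hy
  | smul c x _ hx => rw [map_smul]; exact Submodule.smul_mem _ _ hx

/-- The length filtration. -/
noncomputable def Tf (n k : ℕ) : Submodule ℂ (TT n) :=
  Submodule.span ℂ {x | ∃ l : List (Fin n), l.length ≤ k ∧ x = bv l}

lemma Tf_mono {k m : ℕ} (h : k ≤ m) : Tf n k ≤ Tf n m := by
  apply Submodule.span_mono
  rintro x ⟨l, hl, rfl⟩
  exact ⟨l, hl.trans h, rfl⟩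

lemma bv_mem_Tf (l : List (Fin n)) {k : ℕ} (h : l.length ≤ k) : bv l ∈ Tf n k :=
  Submodule.subset_span ⟨l, h, rfl⟩

lemma Tf_le {k : ℕ} {N : Submodule ℂ (TT n)} (h : ∀ l : List (Fin n), l.length ≤ k → bv l ∈ N) :
    Tf n k ≤ N := by
  rw [Tf, Submodule.span_le]
  rintro x ⟨l, hl, rfl⟩
  exact h l hl

lemma Fo_Tf (i : Fin n) {k : ℕ} {u : TT n} (hu : u ∈ Tf n k) : Fo i u ∈ Tf n (k + 1) := by
  have : Tf n k ≤ (Tf n (k + 1)).comap (Fo i) := Tf_le fun l hl => by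
    rw [Submodule.mem_comap, Fo_bv]
    exact bv_mem_Tf _ (by simpa)
  exact this hu

lemma Eo_Tf (a : Fin n → Fin n → ℤ) (i : Fin n) {k : ℕ} {u : TT n} (hu : u ∈ Tf n k) :
    Eo a i u ∈ Tf n k := by
  have : Tf n k ≤ (Tf n k).comap (Eo a i) := Tf_le fun l hl => by
    rw [Submodule.mem_comap]
    clear hu
    induction l generalizing k with
    | nil => rw [Eo_nil]; exact zero_mem _
    | cons j l ih =>
      rw [List.length_cons] at hl
      obtain ⟨k, rfl⟩ : ∃ k', k = k' + 1 := ⟨k - 1, by omega⟩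
      rw [Eo_bv_cons]
      refine add_mem (Fo_Tf _ (ih (k := k) (by omega))) ?_
      split_ifs
      · rw [Ko_bv]; exact Submodule.smul_mem _ _ (bv_mem_Tf _ (by omega))
      · exact zero_mem _
  exact this hu

end operators

end Onsager

namespace Onsager

section free
variable {n : ℕ}

/-- The canonical projection. -/
noncomputable def piL (I : LieIdeal ℂ (OFL n)) : OFL n →ₗ⁅ℂ⁆ (OFL n ⧸ I) :=
  { I.toSubmodule.mkQ with map_lie' := rfl }

lemma piL_eq_zero (I : LieIdeal ℂ (OFL n)) (x : OFL n) : piL I x = 0 ↔ x ∈ I :=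
  LieSubmodule.Quotient.mk_eq_zero'

lemma piL_surj (I : LieIdeal ℂ (OFL n)) : Function.Surjective (piL I) :=
  Submodule.mkQ_surjective _

/-- A Lie subalgebra containing the generators is everything. -/
lemma fl_top (S : LieSubalgebra ℂ (OFL n)) (h : ∀ i, Bf i ∈ S) (x : OFL n) : x ∈ S := by
  let f : OFL n →ₗ⁅ℂ⁆ S := FreeLieAlgebra.lift ℂ (fun i => ⟨Bf i, h i⟩)
  have : S.incl.comp f = LieHom.id := by
    apply FreeLieAlgebra.hom_ext
    intro i
    simp [f, Bf]
  have h2 := congrArg (fun g : OFL n →ₗ⁅ℂ⁆ OFL n => g x) this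
  simp only [LieHom.comp_apply, LieHom.id_apply] at h2
  rw [← h2]
  exact (f x).2

/-- Right-normed words in the free Lie algebra. -/
noncomputable def fword : Fin n → List (Fin n) → OFL n
  | i, [] => Bf i
  | i, j :: l => ⁅Bf i, fword j l⁆

/-- The homogeneous component of the free Lie algebra. -/
noncomputable def Wd (n m : ℕ) : Submodule ℂ (OFL n) :=
  Submodule.span ℂ {x | ∃ (i : Fin n) (l : List (Fin n)), l.length + 1 = m ∧ x = fword i l}

lemma fword_mem (i : Fin n) (l : List (Fin n)) : fword i l ∈ Wd n (l.length + 1) :=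
  Submodule.subset_span ⟨i, l, rfl, rfl⟩

lemma Wd_le {m : ℕ} {N : Submodule ℂ (OFL n)}
    (h : ∀ (i : Fin n) (l : List (Fin n)), l.length + 1 = m → fword i l ∈ N) : Wd n m ≤ N := by
  rw [Wd, Submodule.span_le]
  rintro x ⟨i, l, hl, rfl⟩
  exact h i l hl

lemma Wd_zero {x : OFL n} (hx : x ∈ Wd n 0) : x = 0 := by
  have : Wd n 0 ≤ ⊥ := Wd_le fun i l h => by omega
  simpa using this hx

lemma Bf_lie_Wd (i : Fin n) {m : ℕ} {x : OFL n} (hx : x ∈ Wd n m) : ⁅Bf i, x⁆ ∈ Wd n (m + 1) := by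
  have : Wd n m ≤ (Wd n (m + 1)).comap (LieAlgebra.ad ℂ (OFL n) (Bf i)) :=
    Wd_le fun j l hl => by
      subst hl
      exact fword_mem i (j :: l)
  exact this hx

lemma fword_lie_Wd (i : Fin n) (l : List (Fin n)) : ∀ {m : ℕ} {x : OFL n}, x ∈ Wd n m →
    ⁅fword i l, x⁆ ∈ Wd n (l.length + 1 + m) := by
  induction l generalizing i with
  | nil =>
    intro m x hx
    have := Bf_lie_Wd i hx
    simpa [fword, add_comm] using this
  | cons j l ih =>
    intro m x hx
    rw [fword, lie_lie, List.length_cons]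
    refine sub_mem ?_ ?_
    · have := Bf_lie_Wd i (ih j hx)
      convert this using 2
      ring
    · have := ih j (Bf_lie_Wd i hx)
      convert this using 2
      ring

lemma lie_Wd {k m : ℕ} {x y : OFL n} (hx : x ∈ Wd n k) (hy : y ∈ Wd n m) :
    ⁅x, y⁆ ∈ Wd n (k + m) := by
  induction hx using Submodule.span_induction with
  | mem x h =>
    obtain ⟨i, l, rfl, rfl⟩ := h
    exact fword_lie_Wd i l hy
  | zero => simp
  | add x y _ _ hx hy => rw [add_lie]; exact add_mem hx hy
  | smul c x _ hx => rw [smul_lie]; exact Submodule.smul_mem _ _ hx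

lemma Wd_iSup : ⨆ m, Wd n m = ⊤ := by
  let S : LieSubalgebra ℂ (OFL n) :=
    { (⨆ m, Wd n m : Submodule ℂ (OFL n)) with
      lie_mem' := by
        intro x y hx hy
        change x ∈ ⨆ m, Wd n m at hx
        change y ∈ ⨆ m, Wd n m at hy
        change ⁅x, y⁆ ∈ ⨆ m, Wd n m
        induction hx using Submodule.iSup_induction' with
        | mem k x hx =>
          induction hy using Submodule.iSup_induction' with
          | mem m y hy => exact Submodule.mem_iSup_of_mem _ (lie_Wd hx hy)
          | zero => simp
          | add y z _ _ h1 h2 => rw [lie_add]; exact add_mem h1 h2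
        | zero => simp
        | add y z _ _ h1 h2 => rw [add_lie]; exact add_mem h1 h2 }
  rw [eq_top_iff]
  intro x _
  exact fl_top S (fun i => Submodule.mem_iSup_of_mem 1 (fword_mem i [])) x

lemma indep_of_eigen {V : Type*} [AddCommGroup V] [Module ℂ V] (τ : Module.End ℂ V)
    (W : ℕ → Submodule ℂ V) (h : ∀ m, ∀ x ∈ W m, τ x = (2 ^ m : ℂ) • x) : iSupIndep W := by
  have hinj : Function.Injective (fun m : ℕ => (2 ^ m : ℂ)) := by
    intro a b hab
    have : ((2 ^ a : ℕ) : ℂ) = ((2 ^ b : ℕ) : ℂ) := by push_cast; exact hab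
    exact Nat.pow_right_injective le_rfl (Nat.cast_injective this)
  refine (τ.eigenspaces_iSupIndep.comp hinj).mono ?_
  intro m x hx
  exact Module.End.mem_eigenspace_iff.mpr (h m x hx)

/-- The scaling automorphism. -/
noncomputable def tau (n : ℕ) : OFL n →ₗ⁅ℂ⁆ OFL n :=
  FreeLieAlgebra.lift ℂ (fun i => (2 : ℂ) • Bf i)

lemma tau_Bf (i : Fin n) : tau n (Bf i) = (2 : ℂ) • Bf i := by
  simp [tau, Bf]

lemma tau_Wd (m : ℕ) (x : OFL n) (hx : x ∈ Wd n m) : tau n x = (2 ^ m : ℂ) • x := by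
  induction hx using Submodule.span_induction with
  | mem x h =>
    obtain ⟨i, l, rfl, rfl⟩ := h
    induction l generalizing i with
    | nil => simp [fword, tau_Bf]
    | cons j l ih =>
      rw [fword, LieHom.map_lie, ih, tau_Bf, smul_lie, lie_smul, smul_smul, List.length_cons,
        pow_succ' _ (l.length + 1)]
  | zero => simp
  | add x y _ _ hx hy => rw [map_add, hx, hy, smul_add]
  | smul c x _ hx => rw [map_smul, hx, smul_comm]

lemma Wd_indep : iSupIndep (Wd n) := indep_of_eigen (tau n).toLinearMap _ tau_Wd

lemma adp_Bf_mem (i j : Fin n) (s : ℕ) : adp (Bf i) (Bf j) s ∈ Wd n (s + 1) := by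
  induction s with
  | zero => rw [adp_zero]; exact fword_mem j []
  | succ s ih => rw [adp_succ]; exact Bf_lie_Wd i ih

lemma serre_mem (a : Fin n → Fin n → ℤ) (i j : Fin n) (hij : i ≠ j) :
    adp (Bf i) (Bf j) (1 - a i j).toNat ∈ serreIdeal a :=
  LieSubmodule.subset_lieSpan ⟨i, j, hij, rfl⟩

lemma serreIdeal_le (a : Fin n → Fin n → ℤ) (I : LieIdeal ℂ (OFL n))
    (h : ∀ i j, i ≠ j → adp (Bf i) (Bf j) (1 - a i j).toNat ∈ I) : serreIdeal a ≤ I := by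
  rw [serreIdeal, LieSubmodule.lieSpan_le]
  rintro x ⟨i, j, hij, rfl⟩
  exact h i j hij

lemma tau_serre (a : Fin n → Fin n → ℤ) (x : OFL n) (hx : x ∈ serreIdeal a) :
    tau n x ∈ serreIdeal a := by
  have : serreIdeal a ≤ LieIdeal.comap (tau n) (serreIdeal a) := by
    apply serreIdeal_le
    intro i j hij
    rw [LieIdeal.mem_comap, tau_Wd _ _ (adp_Bf_mem i j _)]
    exact (serreIdeal a).smul_mem _ (serre_mem a i j hij)
  exact LieIdeal.mem_comap.mp (this hx)

/-- The homogeneous component of `n(A)`. -/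
noncomputable def Nm (a : Fin n → Fin n → ℤ) (m : ℕ) : Submodule ℂ (NilpAlg a) :=
  (Wd n m).map (piL (serreIdeal a)).toLinearMap

lemma Nm_indep (a : Fin n → Fin n → ℤ) : iSupIndep (Nm a) := by
  let t : Module.End ℂ (NilpAlg a) :=
    Submodule.mapQ (serreIdeal a).toSubmodule (serreIdeal a).toSubmodule (tau n).toLinearMap
      (fun x hx => tau_serre a x hx)
  refine indep_of_eigen t _ ?_
  rintro m _ ⟨x, hx, rfl⟩
  have h : t (piL (serreIdeal a) x) = piL (serreIdeal a) (tau n x) := rfl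
  have h2 := tau_Wd m x hx
  rw [h2, map_smul] at h
  exact h

/-- A homogeneous element in a sum of other components vanishes. -/
lemma Nm_eq_zero (a : Fin n → Fin n → ℤ) (m : ℕ) (x : NilpAlg a) (hx : x ∈ Nm a m)
    (hx' : x ∈ ⨆ k, ⨆ (_ : k ≠ m), Nm a k) : x = 0 :=
  Submodule.disjoint_def.mp (Nm_indep a m) x hx hx'

end free

section action

attribute [local instance] LieRing.ofAssociativeRing

variable {n : ℕ}

/-- The action of the free Lie algebra by the operators `F i`. -/
noncomputable def gam (n : ℕ) : OFL n →ₗ⁅ℂ⁆ Module.End ℂ (TT n) :=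
  FreeLieAlgebra.lift ℂ (fun i => Fo i)

/-- The action of the free Lie algebra by the operators `B i`. -/
noncomputable def bet (a : Fin n → Fin n → ℤ) : OFL n →ₗ⁅ℂ⁆ Module.End ℂ (TT n) :=
  FreeLieAlgebra.lift ℂ (fun i => Bo a i)

lemma gam_Bf (i : Fin n) : gam n (Bf i) = Fo i := by simp [gam, Bf]

lemma bet_Bf (a : Fin n → Fin n → ℤ) (i : Fin n) : bet a (Bf i) = Bo a i := by simp [bet, Bf]

lemma Bo_ap (a : Fin n → Fin n → ℤ) (i : Fin n) (u : TT n) : Bo a i u = Fo i u + Eo a i u := rfl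

lemma gam_lie (x y : OFL n) (u : TT n) :
    gam n ⁅x, y⁆ u = gam n x (gam n y u) - gam n y (gam n x u) := by
  rw [LieHom.map_lie]; rfl

lemma bet_lie (a : Fin n → Fin n → ℤ) (x y : OFL n) (u : TT n) :
    bet a ⁅x, y⁆ u = bet a x (bet a y u) - bet a y (bet a x u) := by
  rw [LieHom.map_lie]; rfl

lemma bet_add (a : Fin n → Fin n → ℤ) (x y : OFL n) (u : TT n) :
    bet a (x + y) u = bet a x u + bet a y u := by
  rw [map_add]; rfl

lemma bet_smul (a : Fin n → Fin n → ℤ) (c : ℂ) (x : OFL n) (u : TT n) :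
    bet a (c • x) u = c • bet a x u := by
  rw [map_smul]; rfl

lemma bet_zero (a : Fin n → Fin n → ℤ) (u : TT n) :
    bet a 0 u = 0 := by
  rw [map_zero]; rfl

lemma gam_add (x y : OFL n) (u : TT n) :
    gam n (x + y) u = gam n x u + gam n y u := by
  rw [map_add]; rfl

lemma gam_smul (c : ℂ) (x : OFL n) (u : TT n) :
    gam n (c • x) u = c • gam n x u := by
  rw [map_smul]; rfl

lemma gam_zero (u : TT n) :
    gam n 0 u = 0 := by
  rw [map_zero]; rfl

lemma bet_JJ (A : GCM n) (x : OFL n) : ∀ u ∈ JJ A.a, bet A.a x u ∈ JJ A.a := by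
  let S : LieSubalgebra ℂ (OFL n) :=
    { carrier := {x | ∀ u ∈ JJ A.a, bet A.a x u ∈ JJ A.a}
      add_mem' := fun hx hy u hu => by rw [bet_add]; exact add_mem (hx u hu) (hy u hu)
      zero_mem' := fun u hu => by rw [bet_zero]; exact zero_mem _
      smul_mem' := fun c x hx u hu => by rw [bet_smul]; exact Submodule.smul_mem _ _ (hx u hu)
      lie_mem' := fun hx hy u hu => by
        rw [bet_lie]; exact sub_mem (hx _ (hy u hu)) (hy _ (hx u hu)) }
  refine fl_top S (fun i u hu => ?_) x
  rw [bet_Bf, Bo_ap]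
  exact add_mem (Fo_JJ _ _ _ hu) (Eo_JJ _ _ _ hu)

lemma bet_rel (A : GCM n) (x : OFL n) (hx : x ∈ relIdeal A.a) (u : TT n) :
    bet A.a x u ∈ JJ A.a := by
  let I : LieIdeal ℂ (OFL n) :=
    { carrier := {x | ∀ u, bet A.a x u ∈ JJ A.a}
      add_mem' := fun hx hy u => by rw [bet_add]; exact add_mem (hx u) (hy u)
      zero_mem' := fun u => by rw [bet_zero]; exact zero_mem _
      smul_mem' := fun c x hx u => by rw [bet_smul]; exact Submodule.smul_mem _ _ (hx u)
      lie_mem := fun {y x} hx u => by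
        rw [bet_lie]; exact sub_mem (bet_JJ A y _ (hx u)) (hx _) }
  have : relIdeal A.a ≤ I := by
    rw [relIdeal, LieSubmodule.lieSpan_le]
    rintro x ⟨i, j, hij, rfl⟩ u
    have e : bet A.a (∑ s ∈ Finset.range ((1 - A.a i j).toNat + 1),
      (onsagerC (A.a i j) (1 - A.a i j).toNat s : ℂ) •
        ((LieAlgebra.ad ℂ (OFL n) (Bf i)) ^ s) (Bf j)) = So A.a i j := by
      rw [← Bo_relation A i j hij, map_sum]
      refine Finset.sum_congr rfl fun s _ => ?_
      rw [map_smul]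
      have := map_adp (bet A.a) (Bf i) (Bf j) s
      rw [bet_Bf, bet_Bf] at this
      rw [← this]
      rfl
    rw [e]
    exact So_mem_JJ _ _ _ hij _
  exact this hx u

lemma word_filt (a : Fin n → Fin n → ℤ) (i : Fin n) (l : List (Fin n)) : ∀ {k : ℕ} {u : TT n},
    u ∈ Tf n k → bet a (fword i l) u ∈ Tf n (k + l.length + 1) ∧
      bet a (fword i l) u - gam n (fword i l) u ∈ Tf n (k + l.length) := by
  induction l generalizing i with
  | nil =>
    intro k u hu
    rw [fword, bet_Bf, gam_Bf, Bo_ap, add_sub_cancel_left]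
    exact ⟨add_mem (Fo_Tf _ hu) (Tf_mono (Nat.le_succ k) (Eo_Tf _ _ hu)), Eo_Tf _ _ hu⟩
  | cons j l ih =>
    intro k u hu
    have hF := Fo_Tf i hu
    have hE := Eo_Tf a i hu
    obtain ⟨h1, h2⟩ := ih j hu
    obtain ⟨h3, h4⟩ := ih j hF
    obtain ⟨h5, h6⟩ := ih j hE
    rw [fword, bet_lie, gam_lie, bet_Bf, gam_Bf, Bo_ap, Bo_ap, map_add, List.length_cons]
    have e : k + 1 + l.length = k + l.length + 1 := by ring
    rw [e] at h3 h4
    rw [← add_assoc]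
    constructor
    · refine sub_mem (add_mem (Fo_Tf _ h1) (Tf_mono (Nat.le_succ _) (Eo_Tf _ _ h1)))
        (add_mem h3 (Tf_mono (Nat.le_succ _) h5))
    · have := add_mem (sub_mem (add_mem (Fo_Tf i h2) (Eo_Tf a i h1)) h4) (neg_mem h5)
      convert this using 1
      rw [map_sub]
      abel

/-- The value of the map to `n(A)` on words. -/
noncomputable def thVal (a : Fin n → Fin n → ℤ) : List (Fin n) → NilpAlg a
  | [] => 0
  | i :: l => piL (serreIdeal a) (fword i l)

/-- The map to `n(A)`. -/
noncomputable def Th (a : Fin n → Fin n → ℤ) : TT n →ₗ[ℂ] NilpAlg a := mkOp (thVal a)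

/-- The augmentation. -/
noncomputable def aug (n : ℕ) : TT n →ₗ[ℂ] ℂ := mkOp fun l => if l = [] then 1 else 0

lemma aug_Fo (i : Fin n) (u : TT n) : aug n (Fo i u) = 0 := by
  have : (aug n).comp (Fo i) = 0 := op_ext fun l => by
    simp [Fo_bv, aug, mkOp_bv]
  exact LinearMap.congr_fun this u

lemma Th_Fo (a : Fin n → Fin n → ℤ) (i : Fin n) (u : TT n) :
    Th a (Fo i u) = ⁅piL (serreIdeal a) (Bf i), Th a u⁆ + aug n u • piL (serreIdeal a) (Bf i) := by
  have : (Th a).comp (Fo i) = (LieAlgebra.ad ℂ (NilpAlg a) (piL (serreIdeal a) (Bf i))).comp (Th a)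
      + (aug n).smulRight (piL (serreIdeal a) (Bf i)) := op_ext fun l => by
    cases l with
    | nil => simp [Fo_bv, aug, Th, mkOp_bv, thVal, fword]
    | cons j l => simp [Fo_bv, aug, Th, mkOp_bv, thVal, fword]
  exact LinearMap.congr_fun this u

lemma Th_gam (a : Fin n → Fin n → ℤ) {m : ℕ} {x : OFL n} (hx : x ∈ Wd n m) (u : TT n) :
    aug n (gam n x u) = 0 ∧ Th a (gam n x u) =
      ⁅piL (serreIdeal a) x, Th a u⁆ + ((m : ℂ) * aug n u) • piL (serreIdeal a) x := by
  induction hx using Submodule.span_induction generalizing u with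
  | mem x h =>
    obtain ⟨i, l, rfl, rfl⟩ := h
    induction l generalizing i u with
    | nil => simp [fword, gam_Bf, aug_Fo, Th_Fo]
    | cons j l ih =>
      rw [fword, gam_lie, gam_Bf, map_sub, map_sub, aug_Fo, Th_Fo, (ih _ _).1, (ih _ _).2,
        (ih _ _).1, (ih _ _).2, aug_Fo, Th_Fo, LieHom.map_lie]
      refine ⟨by simp, ?_⟩
      simp only [lie_add, lie_smul, mul_zero, zero_smul, add_zero, lie_lie, List.length_cons,
        Nat.cast_add, Nat.cast_one]
      rw [← lie_skew (piL (serreIdeal a) (fword j l)) (piL (serreIdeal a) (Bf i))]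
      module
  | zero => simp [gam_zero]
  | add x y _ _ hx hy =>
    rw [gam_add, map_add, map_add, (hx u).1, (hx u).2, (hy u).1, (hy u).2, map_add, add_lie]
    exact ⟨by simp, by module⟩
  | smul c x _ hx =>
    rw [gam_smul, map_smul, map_smul, (hx u).1, (hx u).2, map_smul, smul_lie]
    exact ⟨by simp, by module⟩

lemma gam_serre (a : Fin n → Fin n → ℤ) (i j : Fin n) :
    gam n (adp (Bf i) (Bf j) (1 - a i j).toNat) = So a i j := by
  rw [map_adp, gam_Bf, gam_Bf]; rfl

lemma Th_JJ (a : Fin n → Fin n → ℤ) (x : TT n) (hx : x ∈ JJ a) : Th a x = 0 := by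
  suffices aug n x = 0 ∧ Th a x = 0 from this.2
  induction hx using Submodule.span_induction with
  | mem x h =>
    obtain ⟨w, i, j, u, hij, rfl⟩ := h
    induction w with
    | nil =>
      have := Th_gam a (adp_Bf_mem i j (1 - a i j).toNat) u
      rw [gam_serre, (piL_eq_zero _ _).mpr (serre_mem a i j hij)] at this
      simpa using this
    | cons k w ih =>
      simp only [List.map_cons, List.prod_cons, Module.End.mul_apply]
      rw [aug_Fo, Th_Fo, ih.1, ih.2]
      simp
  | zero => simp
  | add x y _ _ hx hy => simp [hx, hy]
  | smul c x _ hx => simp [hx]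

lemma Th_Tf (a : Fin n → Fin n → ℤ) (k : ℕ) (u : TT n) (hu : u ∈ Tf n k) :
    Th a u ∈ ⨆ j, ⨆ (_ : j ≠ k + 1), Nm a j := by
  have : Tf n k ≤ (⨆ j, ⨆ (_ : j ≠ k + 1), Nm a j).comap (Th a) := Tf_le fun l hl => by
    rw [Submodule.mem_comap, Th, mkOp_bv]
    cases l with
    | nil => exact zero_mem _
    | cons i l =>
      rw [List.length_cons] at hl
      have h : thVal a (i :: l) ∈ Nm a (l.length + 1) := ⟨_, fword_mem i l, rfl⟩
      exact Submodule.mem_iSup_of_mem _ (Submodule.mem_iSup_of_mem (by omega) h)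
  exact this hu

/-- The free lift of the filtration. -/
noncomputable def Wle (n m : ℕ) : Submodule ℂ (OFL n) :=
  Submodule.span ℂ {x | ∃ (i : Fin n) (l : List (Fin n)), l.length + 1 ≤ m ∧ x = fword i l}

lemma piL_fword (a : Fin n → Fin n → ℤ) (i : Fin n) (l : List (Fin n)) :
    piL (relIdeal a) (fword i l) = word a i l := by
  induction l generalizing i with
  | nil => rfl
  | cons j l ih => rw [fword, LieHom.map_lie, ih]; rfl

lemma Lfil_eq (a : Fin n → Fin n → ℤ) (m : ℕ) :
    Lfil a m = (Wle n m).map (piL (relIdeal a)).toLinearMap := by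
  rw [Lfil, Wle, Submodule.map_span]
  congr 1
  ext x
  constructor
  · rintro ⟨i, l, hl, rfl⟩
    exact ⟨fword i l, ⟨i, l, hl, rfl⟩, piL_fword a i l⟩
  · rintro ⟨_, ⟨i, l, hl, rfl⟩, rfl⟩
    exact ⟨i, l, hl, piL_fword a i l⟩

/-- Injectivity in each degree. -/
lemma key (A : GCM n) (m : ℕ) (x : OFL n) (hx : x ∈ Wd n m)
    (h : piL (relIdeal A.a) x ∈ Lfil A.a (m - 1)) : x ∈ serreIdeal A.a := by
  cases m with
  | zero => rw [Wd_zero hx]; exact zero_mem _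
  | succ k =>
    rw [Nat.add_sub_cancel, Lfil_eq] at h
    obtain ⟨y, hy, hxy⟩ := h
    have hr : x - y ∈ relIdeal A.a := by
      rw [← piL_eq_zero, map_sub, sub_eq_zero]
      exact hxy.symm
    have h1 := Th_JJ A.a _ (bet_rel A _ hr (bv []))
    have h0 : (bv [] : TT n) ∈ Tf n 0 := bv_mem_Tf _ le_rfl
    have h2 : bet A.a y (bv []) ∈ Tf n k := by
      clear hxy hr h1
      induction hy using Submodule.span_induction with
      | mem y h =>
        obtain ⟨i, l, hl, rfl⟩ := h
        exact Tf_mono (by omega) (word_filt A.a i l h0).1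
      | zero => rw [bet_zero]; exact zero_mem _
      | add x y _ _ hx hy => rw [bet_add]; exact add_mem hx hy
      | smul c x _ hx => rw [bet_smul]; exact Submodule.smul_mem _ _ hx
    have h3 : bet A.a x (bv []) - gam n x (bv []) ∈ Tf n k := by
      clear hxy hr h1
      induction hx using Submodule.span_induction with
      | mem y h =>
        obtain ⟨i, l, hl, rfl⟩ := h
        exact Tf_mono (by omega) (word_filt A.a i l h0).2
      | zero => rw [bet_zero, gam_zero, sub_zero]; exact zero_mem _
      | add x y _ _ hx hy =>
        rw [bet_add, gam_add, add_sub_add_comm]; exact add_mem hx hy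
      | smul c x _ hx => rw [bet_smul, gam_smul, ← smul_sub]; exact Submodule.smul_mem _ _ hx
    have h4 := (Th_gam A.a hx (bv [])).2
    have e1 : Th A.a (bv []) = 0 := by rw [Th, mkOp_bv]; rfl
    have e2 : aug n (bv []) = 1 := by rw [aug, mkOp_bv]; simp
    rw [e1, e2, lie_zero, zero_add, mul_one] at h4
    have e3 : bet A.a x (bv []) = bet A.a (x - y) (bv []) + bet A.a y (bv []) := by
      rw [← bet_add, sub_add_cancel]
    have h5 : gam n x (bv []) = bet A.a (x - y) (bv []) + (bet A.a y (bv [])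
        - (bet A.a x (bv []) - gam n x (bv []))) := by
      rw [e3]; abel
    rw [h5, map_add, h1, zero_add] at h4
    have h6 := Th_Tf A.a k _ (sub_mem h2 h3)
    rw [h4] at h6
    have h7 : piL (serreIdeal A.a) x ∈ Nm A.a (k + 1) := ⟨x, hx, rfl⟩
    have h8 := Nm_eq_zero A.a (k + 1) _ (Submodule.smul_mem _ _ h7) h6
    have h9 : ((k + 1 : ℕ) : ℂ) ≠ 0 := Nat.cast_ne_zero.mpr (Nat.succ_ne_zero k)
    rw [smul_eq_zero] at h8
    exact (piL_eq_zero _ _).mp (h8.resolve_left h9)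

end action

end Onsager

namespace Onsager

section graded
variable {n : ℕ}

lemma onsagerC_gt (a : ℤ) (r : ℕ) : ∀ s, r < s → onsagerC a r s = 0 := by
  induction r using Nat.strong_induction_on with
  | _ r ih =>
  intro s hs
  match r, ih, hs with
  | 0, _, hs => simp [onsagerC]; omega
  | 1, _, hs => simp [onsagerC]; omega
  | (r + 2), ih, hs =>
    rw [onsagerC, if_neg (by omega), ih (r + 1) (by omega) (s - 1) (by omega),
      ih r (by omega) s (by omega)]
    simp

lemma onsagerC_self (a : ℤ) (r : ℕ) : onsagerC a r r = 1 := by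
  induction r using Nat.strong_induction_on with
  | _ r ih =>
  match r, ih with
  | 0, _ => simp [onsagerC]
  | 1, _ => simp [onsagerC]
  | (r + 2), ih =>
    have := ih (r + 1) (by omega)
    rw [onsagerC, if_neg (by omega), onsagerC_gt a r (r + 2) (by omega)]
    simpa using this

lemma Lfil_mono (a : Fin n → Fin n → ℤ) {k m : ℕ} (h : k ≤ m) : Lfil a k ≤ Lfil a m := by
  apply Submodule.span_mono
  rintro x ⟨i, l, hl, rfl⟩
  exact ⟨i, l, hl.trans h, rfl⟩

lemma Lfil_zero (a : Fin n → Fin n → ℤ) {x : OnsagerAlg a} (hx : x ∈ Lfil a 0) : x = 0 := by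
  have : Lfil a 0 ≤ ⊥ := by
    rw [Lfil, Submodule.span_le]
    rintro x ⟨i, l, hl, rfl⟩
    omega
  simpa using this hx

lemma piL_Wd (a : Fin n → Fin n → ℤ) {m : ℕ} {x : OFL n} (hx : x ∈ Wd n m) :
    piL (relIdeal a) x ∈ Lfil a m := by
  rw [Lfil_eq]
  refine ⟨x, ?_, rfl⟩
  have : Wd n m ≤ Wle n m := Wd_le fun i l hl => Submodule.subset_span ⟨i, l, hl.le, rfl⟩
  exact this hx

lemma lie_Lfil (a : Fin n → Fin n → ℤ) {j k : ℕ} {x y : OnsagerAlg a} (hx : x ∈ Lfil a j)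
    (hy : y ∈ Lfil a k) : ⁅x, y⁆ ∈ Lfil a (j + k) := by
  induction hx using Submodule.span_induction with
  | mem x h =>
    obtain ⟨i, l, hl, rfl⟩ := h
    induction hy using Submodule.span_induction with
    | mem y h =>
      obtain ⟨i', l', hl', rfl⟩ := h
      rw [← piL_fword, ← piL_fword, ← LieHom.map_lie]
      exact Lfil_mono a (by omega) (piL_Wd a (lie_Wd (fword_mem i l) (fword_mem i' l')))
    | zero => simp
    | add x y _ _ hx hy => rw [lie_add]; exact add_mem hx hy
    | smul c x _ hx => rw [lie_smul]; exact Submodule.smul_mem _ _ hx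
  | zero => simp
  | add x y _ _ hx hy => rw [add_lie]; exact add_mem hx hy
  | smul c x _ hx => rw [smul_lie]; exact Submodule.smul_mem _ _ hx

lemma lie_Lfil_pred (a : Fin n → Fin n → ℤ) {j k : ℕ} {x y : OnsagerAlg a}
    (hx : x ∈ Lfil a (j - 1)) (hy : y ∈ Lfil a k) : ⁅x, y⁆ ∈ Lfil a (j + k - 1) := by
  cases j with
  | zero => rw [Lfil_zero a hx, zero_lie]; exact zero_mem _
  | succ j => exact Lfil_mono a (by omega) (lie_Lfil a hx hy)

lemma lie_Lfil_pred' (a : Fin n → Fin n → ℤ) {j k : ℕ} {x y : OnsagerAlg a}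
    (hx : x ∈ Lfil a j) (hy : y ∈ Lfil a (k - 1)) : ⁅x, y⁆ ∈ Lfil a (j + k - 1) := by
  rw [← lie_skew, add_comm]
  exact neg_mem (lie_Lfil_pred a hy hx)

lemma exists_lift (a : Fin n → Fin n → ℤ) {j : ℕ} {x : OnsagerAlg a} (hx : x ∈ Lfil a j) :
    ∃ u ∈ Wd n j, piL (relIdeal a) u - x ∈ Lfil a (j - 1) := by
  induction hx using Submodule.span_induction with
  | mem x h =>
    obtain ⟨i, l, hl, rfl⟩ := h
    by_cases h : l.length + 1 = j
    · subst h
      exact ⟨fword i l, fword_mem i l, by rw [piL_fword, sub_self]; exact zero_mem _⟩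
    · refine ⟨0, zero_mem _, ?_⟩
      rw [map_zero, zero_sub]
      exact neg_mem (Submodule.subset_span ⟨i, l, by omega, rfl⟩)
  | zero => exact ⟨0, zero_mem _, by simp⟩
  | add x y _ _ hx hy =>
    obtain ⟨u, hu, hu'⟩ := hx
    obtain ⟨v, hv, hv'⟩ := hy
    refine ⟨u + v, add_mem hu hv, ?_⟩
    rw [map_add, add_sub_add_comm]
    exact add_mem hu' hv'
  | smul c x _ hx =>
    obtain ⟨u, hu, hu'⟩ := hx
    refine ⟨c • u, Submodule.smul_mem _ _ hu, ?_⟩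
    rw [map_smul, ← smul_sub]
    exact Submodule.smul_mem _ _ hu'

lemma serre_Lfil (a : Fin n → Fin n → ℤ) (i j : Fin n) (hij : i ≠ j) :
    piL (relIdeal a) (adp (Bf i) (Bf j) (1 - a i j).toNat) ∈ Lfil a (1 - a i j).toNat := by
  have h : piL (relIdeal a) (∑ s ∈ Finset.range ((1 - a i j).toNat + 1),
      (onsagerC (a i j) (1 - a i j).toNat s : ℂ) • adp (Bf i) (Bf j) s) = 0 :=
    (piL_eq_zero _ _).mpr (LieSubmodule.subset_lieSpan ⟨i, j, hij, rfl⟩)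
  rw [Finset.sum_range_succ, onsagerC_self, map_add, Int.cast_one, one_smul] at h
  rw [eq_neg_of_add_eq_zero_right h, map_sum]
  refine neg_mem (sum_mem fun s hs => ?_)
  rw [map_smul]
  refine Submodule.smul_mem _ _ (Lfil_mono a ?_ (piL_Wd a (adp_Bf_mem i j s)))
  have := Finset.mem_range.mp hs
  omega

lemma mkGr_eq (a : Fin n → Fin n → ℤ) (j : ℕ) (x y : OnsagerAlg a) (hx : x ∈ Lfil a j)
    (hy : y ∈ Lfil a j) (h : x - y ∈ Lfil a (j - 1)) : mkGr a j x hx = mkGr a j y hy := by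
  unfold mkGr
  congr 1
  rw [Submodule.Quotient.eq]
  exact h

/-- The decomposition of the free Lie algebra. -/
noncomputable def decomp (n : ℕ) : (DirectSum ℕ fun m => Wd n m) ≃ₗ[ℂ] OFL n :=
  LinearEquiv.ofBijective (DirectSum.coeLinearMap (Wd n))
    (DirectSum.isInternal_submodule_of_iSupIndep_of_iSup_eq_top Wd_indep Wd_iSup)

/-- The degree `m` part of the map to the associated graded. -/
noncomputable def gm (a : Fin n → Fin n → ℤ) (m : ℕ) : Wd n m →ₗ[ℂ] GrMod a m :=
  (Submodule.mkQ _).comp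
    (((piL (relIdeal a)).toLinearMap.comp (Wd n m).subtype).codRestrict (Lfil a m)
      (fun x => piL_Wd a x.2))

/-- The map from the free Lie algebra to the associated graded. -/
noncomputable def Psi (a : Fin n → Fin n → ℤ) : OFL n →ₗ[ℂ] Gr a :=
  (DirectSum.lmap (gm a)).comp (decomp n).symm.toLinearMap

lemma Psi_homog (a : Fin n → Fin n → ℤ) (m : ℕ) (x : OFL n) (hx : x ∈ Wd n m) :
    Psi a x = mkGr a m (piL (relIdeal a) x) (piL_Wd a hx) := by
  have : (decomp n).symm x = DirectSum.lof ℂ ℕ (fun m => Wd n m) m ⟨x, hx⟩ := by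
    rw [LinearEquiv.symm_apply_eq]
    exact (DirectSum.coeLinearMap_lof (Wd n) m ⟨x, hx⟩).symm
  rw [Psi, LinearMap.comp_apply, LinearEquiv.coe_coe, this, DirectSum.lmap_lof]
  rfl

lemma Psi_zero_of (a : Fin n → Fin n → ℤ) (m : ℕ) (x : OFL n) (hx : x ∈ Wd n m)
    (h : piL (relIdeal a) x ∈ Lfil a (m - 1)) : Psi a x = 0 := by
  rw [Psi_homog a m x hx, mkGr_eq a m _ 0 _ (zero_mem _) (by rwa [sub_zero])]
  unfold mkGr
  have : (⟨0, zero_mem _⟩ : Lfil a m) = 0 := rfl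
  rw [this, Submodule.Quotient.mk_zero, map_zero]

/-- An element of the kernel is a sum of homogeneous elements in the kernel. -/
lemma Psi_ker (a : Fin n → Fin n → ℤ) (x : OFL n) (hx : Psi a x = 0) (N : Submodule ℂ (OFL n))
    (h : ∀ m, ∀ y ∈ Wd n m, piL (relIdeal a) y ∈ Lfil a (m - 1) → y ∈ N) : x ∈ N := by
  obtain ⟨d, rfl⟩ := (decomp n).surjective x
  rw [Psi, LinearMap.comp_apply, LinearEquiv.coe_coe, LinearEquiv.symm_apply_apply] at hx
  have hd : ∀ m, (d m : OFL n) ∈ N := by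
    intro m
    refine h m _ (d m).2 ?_
    have h2 : gm a m (d m) = 0 := by
      have := congrArg (fun f : Gr a => f m) hx
      simpa [DirectSum.lmap_apply] using this
    rw [gm, LinearMap.comp_apply, Submodule.mkQ_apply, Submodule.Quotient.mk_eq_zero] at h2
    exact h2
  have e : decomp n d = DirectSum.coeLinearMap (Wd n) d := rfl
  classical
  rw [e, DirectSum.coeLinearMap_eq_dfinsuppSum]
  exact Submodule.dfinsuppSum_mem _ _ _ fun m _ => hd m

lemma Psi_lie (a : Fin n → Fin n → ℤ) (y : OFL n) :
    ∀ x, Psi a x = 0 → Psi a ⁅y, x⁆ = 0 := by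
  let S : LieSubalgebra ℂ (OFL n) :=
    { carrier := {y | ∀ x, Psi a x = 0 → Psi a ⁅y, x⁆ = 0}
      add_mem' := fun hx hy u hu => by rw [add_lie, map_add, hx u hu, hy u hu, add_zero]
      zero_mem' := fun u hu => by rw [zero_lie, map_zero]
      smul_mem' := fun c x hx u hu => by rw [smul_lie, map_smul, hx u hu, smul_zero]
      lie_mem' := fun hx hy u hu => by
        rw [lie_lie, map_sub, hx _ (hy u hu), hy _ (hx u hu), sub_zero] }
  refine fl_top S (fun i x hx => ?_) y
  refine Psi_ker a x hx ((LinearMap.ker (Psi a)).comap (LieAlgebra.ad ℂ (OFL n) (Bf i))) ?_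
  intro m z hz hz'
  change Psi a ⁅Bf i, z⁆ = 0
  have hB : Bf i ∈ Wd n 1 := fword_mem i []
  refine Psi_zero_of a (1 + m) _ (lie_Wd hB hz) ?_
  rw [LieHom.map_lie]
  exact lie_Lfil_pred' a (piL_Wd a hB) hz'

lemma ker_Psi (A : GCM n) : (serreIdeal A.a).toSubmodule = LinearMap.ker (Psi A.a) := by
  apply le_antisymm
  · let I : LieIdeal ℂ (OFL n) :=
      { LinearMap.ker (Psi A.a) with
        lie_mem := fun {y x} hx => Psi_lie A.a y x hx }
    have : serreIdeal A.a ≤ I := by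
      apply serreIdeal_le
      intro i j hij
      exact Psi_zero_of A.a _ _ (adp_Bf_mem i j _) (serre_Lfil A.a i j hij)
    exact this
  · intro x hx
    exact Psi_ker A.a x hx _ (key A)

lemma Psi_surj_homog (a : Fin n → Fin n → ℤ) (j : ℕ) (x : OnsagerAlg a) (hx : x ∈ Lfil a j) :
    ∃ u ∈ Wd n j, piL (relIdeal a) u - x ∈ Lfil a (j - 1) ∧ Psi a u = mkGr a j x hx := by
  obtain ⟨u, hu, h⟩ := exists_lift a hx
  exact ⟨u, hu, h, (Psi_homog a j u hu).trans (mkGr_eq a j _ _ _ _ h)⟩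

lemma Psi_surj (a : Fin n → Fin n → ℤ) : Function.Surjective (Psi a) := by
  intro g
  induction g using DirectSum.induction_on with
  | zero => exact ⟨0, map_zero _⟩
  | of j x =>
    obtain ⟨⟨x, hx⟩, rfl⟩ := Submodule.Quotient.mk_surjective _ x
    obtain ⟨u, _, _, hu⟩ := Psi_surj_homog a j x hx
    exact ⟨u, hu⟩
  | add x y hx hy =>
    obtain ⟨u, rfl⟩ := hx
    obtain ⟨v, rfl⟩ := hy
    exact ⟨u + v, map_add _ _ _⟩

lemma eq_of_sub_mem {M : Type*} [AddCommMonoid M] [Module ℂ M] (I : LieIdeal ℂ (OFL n))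
    (f : OFL n →ₗ[ℂ] M) (h : ∀ x ∈ I, f x = 0) (x y : OFL n) (hxy : piL I x = piL I y) :
    f x = f y := by
  have h1 : x - y ∈ I := by rw [← piL_eq_zero, map_sub, hxy, sub_self]
  have h2 : f (y + (x - y)) = f y := by rw [map_add, h _ h1, add_zero]
  rwa [add_sub_cancel] at h2

/-- Descent of a linear map to the quotient by a Lie ideal. -/
noncomputable def genLift {M : Type*} [AddCommMonoid M] [Module ℂ M] (I : LieIdeal ℂ (OFL n))
    (f : OFL n →ₗ[ℂ] M) (h : ∀ x ∈ I, f x = 0) : (OFL n ⧸ I) →ₗ[ℂ] M where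
  toFun y := f (Function.surjInv (piL_surj I) y)
  map_add' x y := by
    rw [← map_add]
    apply eq_of_sub_mem I f h
    simp only [map_add, Function.surjInv_eq]
  map_smul' c x := by
    rw [RingHom.id_apply, ← map_smul]
    apply eq_of_sub_mem I f h
    simp only [map_smul, Function.surjInv_eq]

lemma genLift_piL {M : Type*} [AddCommMonoid M] [Module ℂ M] (I : LieIdeal ℂ (OFL n))
    (f : OFL n →ₗ[ℂ] M) (h : ∀ x ∈ I, f x = 0) (x : OFL n) :
    genLift I f h (piL I x) = f x :=
  eq_of_sub_mem I f h _ _ (Function.surjInv_eq (piL_surj I) _)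

lemma Psi_serre (A : GCM n) : ∀ x ∈ serreIdeal A.a, Psi A.a x = 0 := by
  intro x hx
  have h : x ∈ (serreIdeal A.a).toSubmodule := hx
  rw [ker_Psi] at h
  exact h

lemma serre_Psi (A : GCM n) (x : OFL n) (hx : Psi A.a x = 0) : x ∈ serreIdeal A.a := by
  have h : x ∈ (serreIdeal A.a).toSubmodule := by
    rw [ker_Psi]
    exact hx
  exact h

/-- The linear map underlying the isomorphism. -/
noncomputable def Phi0 (A : GCM n) : NilpAlg A.a →ₗ[ℂ] Gr A.a :=
  genLift (serreIdeal A.a) (Psi A.a) (Psi_serre A)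

lemma Phi0_piL (A : GCM n) (x : OFL n) : Phi0 A (piL (serreIdeal A.a) x) = Psi A.a x :=
  genLift_piL _ _ (Psi_serre A) x

lemma Phi0_bij (A : GCM n) : Function.Bijective (Phi0 A) := by
  constructor
  · rw [injective_iff_map_eq_zero]
    intro y hy
    obtain ⟨x, rfl⟩ := piL_surj _ y
    rw [Phi0_piL] at hy
    rw [piL_eq_zero]
    exact serre_Psi A x hy
  · intro z
    obtain ⟨x, hx⟩ := Psi_surj A.a z
    exact ⟨piL _ x, (Phi0_piL A x).trans hx⟩

/-- The isomorphism. -/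
noncomputable def Phi (A : GCM n) : NilpAlg A.a ≃ₗ[ℂ] Gr A.a :=
  LinearEquiv.ofBijective (Phi0 A) (Phi0_bij A)

lemma Phi_piL (A : GCM n) (x : OFL n) : Phi A (piL (serreIdeal A.a) x) = Psi A.a x :=
  Phi0_piL A x

end graded

end Onsager

open Onsager in
/-- The map `φ : n(A) → Gr(L(A))`, `e i ↦ [B i]_1`, is an isomorphism of graded Lie
algebras: there is a linear bijection `φ` sending `e i` to `[B i]_1` which intertwines the
Lie bracket of `n(A)` with the induced graded bracket `[[x]_j, [y]_k] = [[x,y]]_{j+k}`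
of `Gr(L(A))`. -/
theorem nilp_iso_graded_onsager {n : ℕ} (A : GCM n) :
    ∃ φ : NilpAlg A.a ≃ₗ[ℂ] Gr A.a,
      (∀ i : Fin n, φ (eN A.a i) = mkGr A.a 1 (B A.a i) (B_mem_Lfil_one A.a i)) ∧
      (∀ (j k : ℕ) (x y : OnsagerAlg A.a) (hx : x ∈ Lfil A.a j) (hy : y ∈ Lfil A.a k)
        (u v : NilpAlg A.a), φ u = mkGr A.a j x hx → φ v = mkGr A.a k y hy →
        ∃ hxy : ⁅x, y⁆ ∈ Lfil A.a (j + k),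
          φ ⁅u, v⁆ = mkGr A.a (j + k) ⁅x, y⁆ hxy) := by
  refine ⟨Phi A, ?_, ?_⟩
  · intro i
    exact (Phi_piL A (Bf i)).trans <| Psi_homog A.a 1 (Bf i) (fword_mem i [])
  · intro j k x y hx hy u v hu hv
    refine ⟨lie_Lfil A.a hx hy, ?_⟩
    obtain ⟨U, hU, hUx, hU'⟩ := Psi_surj_homog A.a j x hx
    obtain ⟨V, hV, hVy, hV'⟩ := Psi_surj_homog A.a k y hy
    have eu : u = piL (serreIdeal A.a) U := by
      apply (Phi A).injective
      rw [hu, Phi_piL, hU']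
    have ev : v = piL (serreIdeal A.a) V := by
      apply (Phi A).injective
      rw [hv, Phi_piL, hV']
    rw [eu, ev, ← LieHom.map_lie, Phi_piL, Psi_homog A.a (j + k) _ (lie_Wd hU hV)]
    apply mkGr_eq
    rw [LieHom.map_lie]
    have e : ⁅piL (relIdeal A.a) U, piL (relIdeal A.a) V⁆ - ⁅x, y⁆ =
        ⁅piL (relIdeal A.a) U - x, piL (relIdeal A.a) V⁆ +
        ⁅x, piL (relIdeal A.a) V - y⁆ := by
      rw [sub_lie, lie_sub]; abel
    rw [e]
    exact add_mem (lie_Lfil_pred A.a hUx (piL_Wd A.a hV)) (lie_Lfil_pred' A.a hx hVy)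
end

section
/- Let g be a complex Lie algebra, Φ a finite subset of an additive abelian group with Φ = −Φ and 0 ∉ Φ, elements h_1, …, h_r ∈ g with [h_i, h_j] = 0, elements e_α ∈ g for α ∈ Φ (with e_γ := 0 for γ ∉ Φ ∪ {0}), integers n_{i,α} =: α(h_i) with (−α)(h_i) = −α(h_i), integers k_i(α), and integers κ_{α,β} (α+β ≠ 0; κ_{α,β} := 0 if α+β ∉ Φ) such that [h_i, e_α] = α(h_i) e_α, [e_α, e_{−α}] = Σ_{i=1}^r k_i(α) h_i, [e_α, e_β] = κ_{α,β} e_{α+β} for α+β ≠ 0, and κ_{−α,−β} = −κ_{α,β}. In the loop algebra Lg := g ⊗ ℂ[u,u⁻¹] (bracket [x⊗u^k, y⊗u^m] = [x,y]⊗u^{k+m}) set y_{α+ℓδ} := e_α⊗u^ℓ − e_{−α}⊗u^{−ℓ} and y^{(i)}_{kδ} := h_i⊗u^k − h_i⊗u^{−k}. Then for all ℓ, m ∈ ℤ: (1) [y_{α+ℓδ}, y_{α+mδ}] = Σ_i k_i(α) y^{(i)}_{(m−ℓ)δ} and [y_{α+ℓδ}, y_{−α+mδ}] = Σ_i k_i(α)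 y^{(i)}_{(m+ℓ)δ}; (2) [y_{α+ℓδ}, y_{β+mδ}] = κ_{α,β} y_{α+β+(ℓ+m)δ} − κ_{α,−β} y_{α−β+(ℓ−m)δ} for α ≠ ±β; (3) [y^{(i)}_{ℓδ}, y_{α+mδ}] = α(h_i) y_{α+(ℓ+m)δ} − α(h_i) y_{α+(m−ℓ)δ}; (4) [y^{(i)}_{ℓδ}, y^{(j)}_{mδ}] = 0. -/
open TensorProduct LaurentPolynomial

namespace LoopStructureConstants

variable {L : Type*} [LieRing L] [LieAlgebra ℂ L]

/-- The loop algebra `Lg = ℂ[u,u⁻¹] ⊗ g`, with `x[k] = u^k ⊗ x`. -/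
abbrev Loop (L : Type*) [LieRing L] [LieAlgebra ℂ L] : Type _ :=
  (LaurentPolynomial ℂ) ⊗[ℂ] L

/-- `x[k] := x ⊗ u^k`. -/
noncomputable def atDeg (x : L) (k : ℤ) : Loop L := (T k : LaurentPolynomial ℂ) ⊗ₜ x

/-- `y_{α+ℓδ} := e_α ⊗ u^ℓ - e_{-α} ⊗ u^{-ℓ}`. -/
noncomputable def yRe {G : Type*} [AddCommGroup G] (e : G → L) (α : G) (ℓ : ℤ) : Loop L :=
  atDeg (e α) ℓ - atDeg (e (-α)) (-ℓ)

/-- `y^{(i)}_{kδ} := h_i ⊗ u^k - h_i ⊗ u^{-k}`. -/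
noncomputable def yIm {r : ℕ} (h : Fin r → L) (i : Fin r) (k : ℤ) : Loop L :=
  atDeg (h i) k - atDeg (h i) (-k)

end LoopStructureConstants

namespace LoopStructureConstants

lemma atDeg_lie {L : Type*} [LieRing L] [LieAlgebra ℂ L] (x y : L) (a b : ℤ) :
    ⁅atDeg x a, atDeg y b⁆ = atDeg ⁅x, y⁆ (a + b) := by
  simp only [atDeg, LieAlgebra.ExtendScalars.bracket_tmul, T_add]

lemma sub_lie_sub {L : Type*} [LieRing L] [LieAlgebra ℂ L] (x y z w : Loop L) :
    ⁅x - y, z - w⁆ = ⁅x, z⁆ - ⁅x, w⁆ - (⁅y, z⁆ - ⁅y, w⁆) :=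
  (sub_lie (L := Loop L) (M := Loop L) x y (z - w)).trans
    (congrArg₂ (· - ·) (lie_sub (L := Loop L) (M := Loop L) x z w)
      (lie_sub (L := Loop L) (M := Loop L) y z w))

lemma atDeg_zsmul {L : Type*} [LieRing L] [LieAlgebra ℂ L] (n : ℤ) (x : L) (a : ℤ) :
    atDeg (n • x) a = n • atDeg x a :=
  map_zsmul (TensorProduct.mk ℂ (LaurentPolynomial ℂ) L (T a)) n x

lemma atDeg_neg {L : Type*} [LieRing L] [LieAlgebra ℂ L] (x : L) (a : ℤ) :
    atDeg (-x) a = - atDeg x a :=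
  map_neg (TensorProduct.mk ℂ (LaurentPolynomial ℂ) L (T a)) x

lemma atDeg_zero {L : Type*} [LieRing L] [LieAlgebra ℂ L] (a : ℤ) :
    atDeg (0 : L) a = 0 :=
  map_zero (TensorProduct.mk ℂ (LaurentPolynomial ℂ) L (T a))

lemma atDeg_sum {L : Type*} [LieRing L] [LieAlgebra ℂ L] {r : ℕ} (f : Fin r → L) (a : ℤ) :
    atDeg (∑ i, f i) a = ∑ i, atDeg (f i) a :=
  map_sum (TensorProduct.mk ℂ (LaurentPolynomial ℂ) L (T a)) f _

lemma sum_yIm {L : Type*} [LieRing L] [LieAlgebra ℂ L] {r : ℕ} (h : Fin r → L)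
    (k : Fin r → ℤ) (a : ℤ) :
    ∑ i, k i • yIm h i a = atDeg (∑ i, k i • h i) a - atDeg (∑ i, k i • h i) (-a) := by
  simp only [yIm, atDeg_sum, atDeg_zsmul, smul_sub, Finset.sum_sub_distrib]

end LoopStructureConstants

open LoopStructureConstants in
/-- Structure constants of the fixed-point subalgebra of an untwisted affine Lie algebra,
computed in the loop algebra `Lg = g ⊗ ℂ[u,u⁻¹]`: the four families of bracket relations
for the elements `y_{α+ℓδ}` and `y^{(i)}_{kδ}`. -/
theorem loop_structure_constants
    {L : Type*} [LieRing L] [LieAlgebra ℂ L]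
    {G : Type*} [AddCommGroup G] {r : ℕ}
    (Φ : Finset G) (hΦneg : ∀ γ : G, γ ∈ Φ ↔ -γ ∈ Φ) (hΦ0 : (0 : G) ∉ Φ)
    (h : Fin r → L) (hcomm : ∀ i j, ⁅h i, h j⁆ = 0)
    (e : G → L) (he : ∀ γ : G, γ ∉ Φ → γ ≠ 0 → e γ = 0)
    (nn : G → Fin r → ℤ) (hnneg : ∀ α i, nn (-α) i = - nn α i)
    (k : G → Fin r → ℤ)
    (κ : G → G → ℤ)
    (hκ0 : ∀ α β : G, α + β ≠ 0 → α + β ∉ Φ → κ α β = 0)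
    (hhe : ∀ i, ∀ α ∈ Φ, ⁅h i, e α⁆ = nn α i • e α)
    (hcartan : ∀ α ∈ Φ, ⁅e α, e (-α)⁆ = ∑ i, k α i • h i)
    (hbr : ∀ α ∈ Φ, ∀ β ∈ Φ, α + β ≠ 0 → ⁅e α, e β⁆ = κ α β • e (α + β))
    (hskew : ∀ α ∈ Φ, ∀ β ∈ Φ, α + β ≠ 0 → κ (-α) (-β) = -κ α β) :
    (∀ α ∈ Φ, ∀ ℓ m : ℤ,
      ⁅yRe e α ℓ, yRe e α m⁆ = ∑ i, k α i • yIm h i (m - ℓ) ∧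
      ⁅yRe e α ℓ, yRe e (-α) m⁆ = ∑ i, k α i • yIm h i (m + ℓ)) ∧
    (∀ α ∈ Φ, ∀ β ∈ Φ, α ≠ β → α ≠ -β → ∀ ℓ m : ℤ,
      ⁅yRe e α ℓ, yRe e β m⁆ =
        κ α β • yRe e (α + β) (ℓ + m) - κ α (-β) • yRe e (α - β) (ℓ - m)) ∧
    (∀ α ∈ Φ, ∀ (i : Fin r) (ℓ m : ℤ),
      ⁅yIm h i ℓ, yRe e α m⁆ =
        nn α i • yRe e α (ℓ + m) - nn α i • yRe e α (m - ℓ)) ∧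
    (∀ (i j : Fin r) (ℓ m : ℤ), ⁅yIm h i ℓ, yIm h j m⁆ = 0) := by
  have hneg : ∀ α ∈ Φ, -α ∈ Φ := fun α hα => (hΦneg α).1 hα
  refine ⟨fun α hα ℓ m => ⟨?_, ?_⟩, fun α hα β hβ h1 h2 ℓ m => ?_, fun α hα i ℓ m => ?_,
    fun i j ℓ m => ?_⟩
  · rw [sum_yIm, ← hcartan α hα]
    simp only [yRe, sub_lie_sub, atDeg_lie, lie_self, atDeg_zero]
    rw [← lie_skew (e (-α)) (e α), atDeg_neg, show -ℓ + m = m - ℓ by ring,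
      show -(m - ℓ) = ℓ + -m by ring]
    abel
  · rw [sum_yIm, ← hcartan α hα]
    simp only [yRe, sub_lie_sub, atDeg_lie, lie_self, atDeg_zero, neg_neg]
    rw [← lie_skew (e (-α)) (e α), atDeg_neg, show -ℓ + -m = -(m + ℓ) by ring,
      show ℓ + m = m + ℓ by ring]
    abel
  · have n1 : α + β ≠ 0 := fun H => h2 (eq_neg_of_add_eq_zero_left H)
    have n2 : α + -β ≠ 0 := fun H => h1 (by simpa using eq_neg_of_add_eq_zero_left H)
    have n3 : -α + -β ≠ 0 := fun H => n1 (by rw [← neg_eq_zero, neg_add]; exact H)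
    have n4 : -α + β ≠ 0 := fun H => n2 (by rw [← neg_eq_zero, neg_add, neg_neg]; exact H)
    have s1 := hskew α hα β hβ n1
    have s2 := hskew α hα (-β) (hneg β hβ) n2
    rw [neg_neg] at s2
    simp only [yRe, sub_lie_sub, atDeg_lie]
    rw [hbr α hα β hβ n1, hbr α hα _ (hneg β hβ) n2, hbr _ (hneg α hα) β hβ n4,
      hbr _ (hneg α hα) _ (hneg β hβ) n3, s1, s2]
    simp only [atDeg_zsmul, atDeg_neg, smul_sub, neg_smul]
    rw [show -(α + β) = -α + -β by abel, show -(α - β) = -α + β by abel,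
      show α - β = α + -β by abel, show -(ℓ + m) = -ℓ + -m by ring,
      show -(ℓ - m) = -ℓ + m by ring, show ℓ - m = ℓ + -m by ring]
    abel
  · simp only [yRe, yIm, sub_lie_sub, atDeg_lie]
    rw [hhe i α hα, hhe i _ (hneg α hα), hnneg]
    simp only [atDeg_zsmul, atDeg_neg, smul_sub, neg_smul]
    rw [show -(ℓ + m) = -ℓ + -m by ring, show -(m - ℓ) = ℓ + -m by ring,
      show m - ℓ = -ℓ + m by ring]
    abel
  · simp only [yIm, sub_lie_sub, atDeg_lie, hcomm, atDeg_zero, sub_zero]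
end
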